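/- arXiv:1208.2676 — 2 statements merged into one kernel-verified Lean document; each statement's English description precedes it below -/
import Mathlib

section
/- (Weighted bump functions on an interval) Let α > 0 and 0 < r ≤ a. Then there exist a nonnegative function ζ ∈ C^∞_0(ℝ_+) and a constant N = N(α), independent of a and r, such that: supp ζ ⊂ (a−r, a+r), ∫_{a−r}^{a+r} ζ(s) s^α ds = 1, (sup ζ) · ∫_{a−r}^{a+r} s^α ds ≤ N, and (sup |ζ'|) · ∫_{a−r}^{a+r} s^α ds ≤ N/r. -/
open MeasureTheory Set
open scoped ENNReal BigOperators

noncomputable section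

abbrev Esp (d : ℕ) := EuclideanSpace ℝ (Fin d)

/-- The spatial half space `{x : x^1 > 0}`. -/
def halfSp (d : ℕ) [NeZero d] : Set (Esp d) := {x | 0 < x 0}

/-- The space-time half space `Ω = ℝ × ℝ^d_+`. -/
def halfST (d : ℕ) [NeZero d] : Set (ℝ × Esp d) := {z | 0 < z.2 0}

/-- The "slab" ball `𝓑_r(x) = (x^1-r, x^1+r) × B'_r(x')`. -/
def sball (d : ℕ) [NeZero d] (r : ℝ) (x : Esp d) : Set (Esp d) :=
  {y | |y 0 - x 0| < r ∧ ∑ i ∈ Finset.univ.erase (0 : Fin d), (y i - x i) ^ 2 < r ^ 2}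

/-- The parabolic cylinder `𝓠_r(t,x) = (t, t+r²) × 𝓑_r(x)`. -/
def pcyl (d : ℕ) [NeZero d] (r t : ℝ) (x : Esp d) : Set (ℝ × Esp d) :=
  Set.Ioo t (t + r ^ 2) ×ˢ sball d r x

/-- The weighted measure `ν(dx) = (x^1)^α dx` on the half space. -/
def nuW (d : ℕ) [NeZero d] (α : ℝ) : Measure (Esp d) :=
  ((volume : Measure (Esp d)).withDensity fun x => ENNReal.ofReal ((x 0) ^ α)).restrict (halfSp d)

/-- The weighted measure `μ(dtdx) = (x^1)^α dx dt` on `Ω`. -/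
def muW (d : ℕ) [NeZero d] (α : ℝ) : Measure (ℝ × Esp d) :=
  ((volume : Measure (ℝ × Esp d)).withDensity fun z => ENNReal.ofReal ((z.2 0) ^ α)).restrict
    (halfST d)

/-- Real-valued average of `g` over `S` with respect to `μ`. -/
def avgR {γ : Type*} [MeasurableSpace γ] (μ : Measure γ) (S : Set γ) (g : γ → ℝ) : ℝ :=
  (μ S).toReal⁻¹ * ∫ z in S, g z ∂μ

/-- `ℝ≥0∞`-valued average of a (nonnegative) function `g` over `S` with respect to `μ`. -/
def eavg {γ : Type*} [MeasurableSpace γ] (μ : Measure γ) (S : Set γ) (g : γ → ℝ) : ℝ≥0∞ :=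
  (μ S)⁻¹ * ∫⁻ z in S, ENNReal.ofReal (g z) ∂μ

/-- Time derivative `u_t`. -/
def ptime (d : ℕ) (u : ℝ × Esp d → ℝ) (z : ℝ × Esp d) : ℝ :=
  deriv (fun s => u (s, z.2)) z.1

/-- Spatial partial derivative `u_{x^i}`. -/
def psp (d : ℕ) [NeZero d] (i : Fin d) (u : ℝ × Esp d → ℝ) (z : ℝ × Esp d) : ℝ :=
  fderiv ℝ (fun y => u (z.1, y)) z.2 (EuclideanSpace.single i 1)

/-- Norm of the spatial gradient `|u_x|`. -/
def gradNorm (d : ℕ) (u : ℝ × Esp d → ℝ) (z : ℝ × Esp d) : ℝ :=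
  ‖fderiv ℝ (fun y => u (z.1, y)) z.2‖

/-- (Frobenius) norm of the spatial Hessian `|u_{xx}|`. -/
def hessNorm (d : ℕ) [NeZero d] (u : ℝ × Esp d → ℝ) (z : ℝ × Esp d) : ℝ :=
  Real.sqrt (∑ i, ∑ j, psp d i (psp d j u) z ^ 2)

/-- `|u_{xx}(w) - (u_{xx})_S|` where the mean of the Hessian over `S` is taken entrywise
with respect to `μ = muW d α`. -/
def hessDiff (d : ℕ) [NeZero d] (α : ℝ) (u : ℝ × Esp d → ℝ) (S : Set (ℝ × Esp d))
    (w : ℝ × Esp d) : ℝ :=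
  Real.sqrt (∑ i, ∑ j,
    (psp d i (psp d j u) w - avgR (muW d α) S (psp d i (psp d j u))) ^ 2)

/-- Partial derivative for functions of the space variable only. -/
def pspS (d : ℕ) [NeZero d] (i : Fin d) (v : Esp d → ℝ) (x : Esp d) : ℝ :=
  fderiv ℝ v x (EuclideanSpace.single i 1)

/-- Iterated spatial derivative `D^β u` along a list of coordinate directions. -/
def mderiv (d : ℕ) [NeZero d] : List (Fin d) → (ℝ × Esp d → ℝ) → ℝ × Esp d → ℝ
  | [], u => u
  | i :: l, u => psp d i (mderiv d l u)

/-- Iterated derivative along a list of coordinate directions, spatial functions. -/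
def mderivS (d : ℕ) [NeZero d] : List (Fin d) → (Esp d → ℝ) → Esp d → ℝ
  | [], v => v
  | i :: l, v => pspS d i (mderivS d l v)

/-- Uniform ellipticity for coefficients depending on `t` only. -/
def ellipT (d : ℕ) (A : ℝ → Fin d → Fin d → ℝ) (δ K : ℝ) : Prop :=
  ∀ (t : ℝ) (ξ : Fin d → ℝ),
    δ * ∑ i, ξ i ^ 2 ≤ ∑ i, ∑ j, A t i j * ξ i * ξ j ∧
    ∑ i, ∑ j, A t i j * ξ i * ξ j ≤ K * ∑ i, ξ i ^ 2

/-- Uniform ellipticity for coefficients depending on `(t,x)`. -/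
def ellipTX (d : ℕ) (A : ℝ × Esp d → Fin d → Fin d → ℝ) (δ K : ℝ) : Prop :=
  ∀ (z : ℝ × Esp d) (ξ : Fin d → ℝ),
    δ * ∑ i, ξ i ^ 2 ≤ ∑ i, ∑ j, A z i j * ξ i * ξ j ∧
    ∑ i, ∑ j, A z i j * ξ i * ξ j ≤ K * ∑ i, ξ i ^ 2

/-- `u ∈ C^∞_0(S)`: smooth, compactly supported, with support contained in `S`. -/
def CinfC {E : Type*} [NormedAddCommGroup E] [NormedSpace ℝ E] (u : E → ℝ) (S : Set E) : Prop :=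
  ContDiff ℝ (⊤ : ℕ∞) u ∧ HasCompactSupport u ∧ tsupport u ⊆ S

/-- Weighted parabolic maximal function `𝕄g`. -/
def maxFn (d : ℕ) [NeZero d] (α : ℝ) (g : ℝ × Esp d → ℝ) (z : ℝ × Esp d) : ℝ≥0∞ :=
  ⨆ (r : ℝ) (t : ℝ) (x : Esp d)
    (_ : 0 < r ∧ pcyl d r t x ⊆ halfST d ∧ z ∈ pcyl d r t x),
    ENNReal.ofReal (avgR (muW d α) (pcyl d r t x) fun w => |g w|)

/-- Weighted parabolic sharp function `g^♯`. -/
def sharpFn (d : ℕ) [NeZero d] (α : ℝ) (g : ℝ × Esp d → ℝ) (z : ℝ × Esp d) : ℝ≥0∞ :=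
  ⨆ (r : ℝ) (t : ℝ) (x : Esp d)
    (_ : 0 < r ∧ pcyl d r t x ⊆ halfST d ∧ z ∈ pcyl d r t x),
    ENNReal.ofReal (avgR (muW d α) (pcyl d r t x)
      fun w => |g w - avgR (muW d α) (pcyl d r t x) g|)

/-- Sharp function of the spatial Hessian `(u_{xx})^♯`. -/
def sharpHess (d : ℕ) [NeZero d] (α : ℝ) (u : ℝ × Esp d → ℝ) (z : ℝ × Esp d) : ℝ≥0∞ :=
  ⨆ (r : ℝ) (t : ℝ) (x : Esp d)
    (_ : 0 < r ∧ pcyl d r t x ⊆ halfST d ∧ z ∈ pcyl d r t x),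
    ENNReal.ofReal (avgR (muW d α) (pcyl d r t x) (hessDiff d α u (pcyl d r t x)))

/-- Weighted mean oscillation `osc^θ_x(a, 𝓠_r(t,x))` (Frobenius norm of matrix differences). -/
def oscWgt (d : ℕ) [NeZero d] (α : ℝ) (A : ℝ × Esp d → Fin d → Fin d → ℝ)
    (r t : ℝ) (x : Esp d) : ℝ :=
  (r ^ 2)⁻¹ * ∫ s in Set.Ioo t (t + r ^ 2),
    avgR (nuW d α) (sball d r x) fun y =>
      avgR (nuW d α) (sball d r x) fun z =>
        Real.sqrt (∑ i, ∑ j, (A (s, y) i j - A (s, z) i j) ^ 2)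

/-- Unweighted (Lebesgue) mean oscillation `osc_x(a, 𝓠_r(t,x))`. -/
def oscLeb (d : ℕ) [NeZero d] (A : ℝ × Esp d → Fin d → Fin d → ℝ)
    (r t : ℝ) (x : Esp d) : ℝ :=
  (r ^ 2)⁻¹ * ∫ s in Set.Ioo t (t + r ^ 2),
    avgR (volume : Measure (Esp d)) (sball d r x) fun y =>
      avgR (volume : Measure (Esp d)) (sball d r x) fun z =>
        Real.sqrt (∑ i, ∑ j, (A (s, y) i j - A (s, z) i j) ^ 2)

/-- `𝓠_r(t,x) ∈ 𝔹(R,κ)`. -/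
def inBQ (d : ℕ) [NeZero d] (R κ r t : ℝ) (x : Esp d) : Prop :=
  0 < x 0 ∧ 0 < r ∧ r ≤ κ * x 0 ∧ x 0 + r ≤ R

/-- `a^{#(θ)}_{R,κ}`, the supremum of weighted oscillations over `𝔹(R,κ)`. -/
def aSharp (d : ℕ) [NeZero d] (α R κ : ℝ) (A : ℝ × Esp d → Fin d → Fin d → ℝ) : ℝ :=
  sSup {v : ℝ | ∃ r t x, inBQ d R κ r t x ∧ v = oscWgt d α A r t x}

/-- `a^{#(θ)}_κ = sup_{R>0} a^{#(θ)}_{R,κ}`. -/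
def aSharpFull (d : ℕ) [NeZero d] (α κ : ℝ) (A : ℝ × Esp d → Fin d → Fin d → ℝ) : ℝ :=
  sSup {v : ℝ | ∃ (r t : ℝ) (x : Esp d), 0 < x 0 ∧ 0 < r ∧ r ≤ κ * x 0 ∧
    v = oscWgt d α A r t x}

/-- The weighted Sobolev-type norm `⟦v⟧^p = Σ_{|β| ≤ n} ∫ ((x^1)^{|β|}|D^β v|)^p (x^1)^{θ-d} dx`,
where mixed partial derivatives are enumerated by ordered tuples of directions. -/
def wnorm (d : ℕ) [NeZero d] (p θ : ℝ) (n : ℕ) (v : Esp d → ℝ) : ℝ :=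
  ∑ k ∈ Finset.range (n + 1), ∑ σ : Fin k → Fin d,
    ∫ x in halfSp d, ((x 0) ^ (k : ℝ) * |mderivS d (List.ofFn σ) v x|) ^ p * (x 0) ^ (θ - d)

/-- The cylinder `𝓠_r(a) = 𝓠_r(0,(a,0))`. -/
def cylA (d : ℕ) [NeZero d] (r aa : ℝ) : Set (ℝ × Esp d) :=
  pcyl d r 0 (EuclideanSpace.single (0 : Fin d) aa)

/-- The weighted measure of `(a - r, a + r)` is at most `4 * 2 ^ α` times `(r / 2) * a ^ α`. -/
lemma setIntegral_rpow_le {α a r : ℝ} (hα : 0 ≤ α) (hr : 0 < r) (hra : r ≤ a) :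
    (∫ s in Set.Ioo (a - r) (a + r), s ^ α) ≤ 4 * 2 ^ α * (r / 2 * a ^ α) := by
  have hcont : Continuous fun s : ℝ => s ^ α := continuous_id.rpow_const fun _ => Or.inr hα
  have hle : (∫ s in Set.Ioo (a - r) (a + r), s ^ α) ≤
      ∫ _ in Set.Ioo (a - r) (a + r), (2 * a) ^ α := by
    refine setIntegral_mono_on (hcont.integrableOn_Icc.mono_set Ioo_subset_Icc_self)
      (by simp) measurableSet_Ioo fun s hs => ?_
    exact Real.rpow_le_rpow (by linarith [hs.1]) (by linarith [hs.2]) hα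
  refine hle.trans_eq ?_
  rw [setIntegral_const, Real.volume_real_Ioo_of_le (by linarith),
    Real.mul_rpow (by norm_num) (by linarith), smul_eq_mul]
  ring

/-- A nonnegative continuous function that is at least `1` on `[a, a + r / 2]` has weighted
integral over `(a - r, a + r)` at least `(r / 2) * a ^ α`. -/
lemma le_setIntegral_mul_rpow {α a r : ℝ} (hα : 0 ≤ α) (hr : 0 < r) (hra : r ≤ a)
    {ψ : ℝ → ℝ} (hψ : Continuous ψ) (hψ0 : ∀ s, 0 ≤ ψ s)
    (hψ1 : ∀ s ∈ Set.Icc a (a + r / 2), 1 ≤ ψ s) :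
    r / 2 * a ^ α ≤ ∫ s in Set.Ioo (a - r) (a + r), ψ s * s ^ α := by
  have hcont : Continuous fun s : ℝ => ψ s * s ^ α :=
    hψ.mul (continuous_id.rpow_const fun _ => Or.inr hα)
  have hsub : Set.Icc a (a + r / 2) ⊆ Set.Ioo (a - r) (a + r) := fun s hs =>
    ⟨by linarith [hs.1], by linarith [hs.2]⟩
  calc r / 2 * a ^ α = ∫ _ in Set.Icc a (a + r / 2), a ^ α := by
        rw [setIntegral_const, Real.volume_real_Icc_of_le (by linarith), smul_eq_mul]
        ring
    _ ≤ ∫ s in Set.Icc a (a + r / 2), ψ s * s ^ α := by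
        refine setIntegral_mono_on (by simp) hcont.integrableOn_Icc measurableSet_Icc
          fun s hs => ?_
        have hpow : a ^ α ≤ s ^ α := Real.rpow_le_rpow (by linarith) hs.1 hα
        have hpos : 0 ≤ s ^ α := Real.rpow_nonneg (by linarith [hs.1]) _
        nlinarith [hψ1 s hs]
    _ ≤ ∫ s in Set.Ioo (a - r) (a + r), ψ s * s ^ α := by
        refine setIntegral_mono_set (hcont.integrableOn_Icc.mono_set Ioo_subset_Icc_self) ?_
          hsub.eventuallyLE
        filter_upwards [ae_restrict_mem measurableSet_Ioo] with s hs
        exact mul_nonneg (hψ0 s) (Real.rpow_nonneg (by linarith [hs.1]) _)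

/-- **Weighted bump functions on an interval.** -/
theorem stmt3 (α : ℝ) (hα : 0 < α) :
    ∃ N : ℝ, 0 < N ∧ ∀ a r : ℝ, 0 < r → r ≤ a →
      ∃ ζ : ℝ → ℝ, ContDiff ℝ (⊤ : ℕ∞) ζ ∧ HasCompactSupport ζ ∧ (∀ s, 0 ≤ ζ s) ∧
        tsupport ζ ⊆ Set.Ioo (a - r) (a + r) ∧
        (∫ s in Set.Ioo (a - r) (a + r), ζ s * s ^ α) = 1 ∧
        (⨆ s, ζ s) * (∫ s in Set.Ioo (a - r) (a + r), s ^ α) ≤ N ∧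
        (⨆ s, |deriv ζ s|) * (∫ s in Set.Ioo (a - r) (a + r), s ^ α) ≤ N / r := by
  let φ : ContDiffBump (0 : ℝ) := ⟨1 / 2, 3 / 4, by norm_num, by norm_num⟩
  have hφ : ContDiff ℝ (⊤ : ℕ∞) φ := φ.contDiff
  obtain ⟨M, hM⟩ := (hφ.continuous_deriv (by simp)).bounded_above_of_compact_support
    φ.hasCompactSupport.deriv
  have hM0 : 0 ≤ M := (norm_nonneg _).trans (hM 0)
  have hC : (0 : ℝ) < 4 * 2 ^ α := by positivity
  refine ⟨4 * 2 ^ α * (1 + M), by positivity, fun a r hr hra => ?_⟩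
  have ha : 0 < a := hr.trans_le hra
  let ψ : ℝ → ℝ := fun s => φ ((s - a) / r)
  have hψ : ContDiff ℝ (⊤ : ℕ∞) ψ :=
    hφ.comp ((contDiff_id.sub contDiff_const).div_const r)
  have hψ0 : ∀ s, 0 ≤ ψ s := fun s => φ.nonneg
  have hψ1 : ∀ s ∈ Set.Icc a (a + r / 2), 1 ≤ ψ s := fun s hs => by
    refine (φ.one_of_mem_closedBall ?_).ge
    rw [mem_closedBall_zero_iff, Real.norm_eq_abs, abs_of_nonneg
      (div_nonneg (by linarith [hs.1]) hr.le), div_le_iff₀ hr]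
    change s - a ≤ 1 / 2 * r
    linarith [hs.2]
  have hψd : ∀ s, |deriv ψ s| ≤ M / r := fun s => by
    have hd : HasDerivAt ψ (deriv φ ((s - a) / r) * (1 / r)) s :=
      ((hφ.differentiable (by simp)) _).hasDerivAt.comp s
        (((hasDerivAt_id s).sub_const a).div_const r)
    rw [hd.deriv, abs_mul, abs_of_pos (one_div_pos.2 hr), mul_one_div]
    gcongr
    exact hM _
  have hψsupp : tsupport ψ ⊆ Set.Icc (a - 3 / 4 * r) (a + 3 / 4 * r) := by
    refine closure_minimal (fun s hs => ?_) isClosed_Icc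
    have hmem : (s - a) / r ∈ Function.support φ := hs
    rw [φ.support_eq, mem_ball_zero_iff, Real.norm_eq_abs, abs_div, abs_of_pos hr,
      div_lt_iff₀ hr] at hmem
    change |s - a| < 3 / 4 * r at hmem
    rw [abs_lt] at hmem
    exact ⟨by linarith, by linarith⟩
  set W := ∫ s in Set.Ioo (a - r) (a + r), s ^ α
  set J := ∫ s in Set.Ioo (a - r) (a + r), ψ s * s ^ α with hJ
  have hJlow : r / 2 * a ^ α ≤ J := le_setIntegral_mul_rpow hα.le hr hra hψ.continuous hψ0 hψ1
  have hJpos : 0 < J := lt_of_lt_of_le (by positivity) hJlow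
  have hW0 : 0 ≤ W := setIntegral_nonneg measurableSet_Ioo fun s hs =>
    Real.rpow_nonneg (by linarith [hs.1]) _
  have hWJ : W / J ≤ 4 * 2 ^ α := by
    rw [div_le_iff₀ hJpos]
    exact (setIntegral_rpow_le hα.le hr hra).trans (by gcongr)
  have hsupp : tsupport (fun s => J⁻¹ * ψ s) ⊆ Set.Icc (a - 3 / 4 * r) (a + 3 / 4 * r) :=
    (tsupport_mul_subset_right (f := fun _ => J⁻¹) (g := ψ)).trans hψsupp
  refine ⟨fun s => J⁻¹ * ψ s, contDiff_const.mul hψ,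
    isCompact_Icc.of_isClosed_subset (isClosed_tsupport _) hsupp,
    fun s => mul_nonneg (inv_nonneg.2 hJpos.le) (hψ0 s),
    hsupp.trans fun s hs => ⟨by linarith [hs.1], by linarith [hs.2]⟩, ?_, ?_, ?_⟩
  · simp_rw [mul_assoc]
    rw [integral_const_mul, ← hJ, inv_mul_cancel₀ hJpos.ne']
  · have hsup : (⨆ s, J⁻¹ * ψ s) ≤ J⁻¹ := ciSup_le fun s =>
      mul_le_of_le_one_right (inv_nonneg.2 hJpos.le) φ.le_one
    calc (⨆ s, J⁻¹ * ψ s) * W ≤ J⁻¹ * W := by gcongr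
      _ = W / J := by ring
      _ ≤ 4 * 2 ^ α := hWJ
      _ ≤ 4 * 2 ^ α * (1 + M) := le_mul_of_one_le_right hC.le (by linarith)
  · have hsup : (⨆ s, |deriv (fun s => J⁻¹ * ψ s) s|) ≤ J⁻¹ * (M / r) := ciSup_le fun s => by
      rw [deriv_const_mul _ ((hψ.differentiable (by simp)) s), abs_mul,
        abs_of_pos (inv_pos.2 hJpos)]
      gcongr
      exact hψd s
    calc (⨆ s, |deriv (fun s => J⁻¹ * ψ s) s|) * W ≤ J⁻¹ * (M / r) * W := by gcongr
      _ = W / J * (M / r) := by ring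
      _ ≤ 4 * 2 ^ α * ((1 + M) / r) := by gcongr; linarith
      _ = 4 * 2 ^ α * (1 + M) / r := by ring
end
end

section
/- (Weighted cylinder oscillation estimate for solutions of divergence-type parabolic equations) Let p ∈ [1,∞), θ ∈ (d−1, d−1+p), α = θ − d + p, and let a^{ij}(t), 1 ≤ i,j ≤ d, be real measurable functions of t only satisfying δ|ξ|² ≤ Σ_{i,j} a^{ij}(t)ξ^iξ^j ≤ K|ξ|² for all ξ ∈ ℝ^d and all t, with constants 0 < δ ≤ K. Suppose u, f^1, …, f^d, g ∈ C^∞_loc(Ω) and u_t + Σ_{i,j} a^{ij} u_{x^i x^j} = Σ_i (f^i)_{x^i} + g on a cylinder 𝓠_r(a) ⊂ Ω (i.e. 0 < r ≤ a). Then ∫_{𝓠_r(a)} |u − u_{𝓠_r(a)}|^p dμ ≤ N r^p ∫_{𝓠_r(a)} (|u_x|^p + |f|^p + r^p |g|^p) dμ, where f = (f^1,…,f^d) and N = N(θ,p,d,δ,K). -/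
open MeasureTheory Set
open scoped ENNReal BigOperators

noncomputable section

/-- Jensen's inequality for powers, for a finite or infinite measure. -/
theorem lintegral_rpow_le_measure_mul {X : Type*} [MeasurableSpace X] (μ : Measure X) {p : ℝ}
    (hp : 1 ≤ p) {f : X → ℝ≥0∞} (hf : AEMeasurable f μ) :
    (∫⁻ x, f x ∂μ) ^ p ≤ μ univ ^ (p - 1) * ∫⁻ x, f x ^ p ∂μ := by
  rcases hp.eq_or_lt with rfl | hp1
  · simp
  have hpos : 0 < p := by linarith
  have hpq : p.HolderConjugate (p / (p - 1)) := Real.HolderConjugate.conjExponent hp1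
  have h := ENNReal.lintegral_mul_le_Lp_mul_Lq μ hpq hf (aemeasurable_const (b := (1 : ℝ≥0∞)))
  simp only [Pi.mul_apply, mul_one, ENNReal.one_rpow, lintegral_const, one_mul] at h
  calc (∫⁻ x, f x ∂μ) ^ p
      ≤ ((∫⁻ x, f x ^ p ∂μ) ^ (1 / p) * μ univ ^ (1 / (p / (p - 1)))) ^ p := by gcongr
    _ = μ univ ^ (p - 1) * ∫⁻ x, f x ^ p ∂μ := by
        rw [ENNReal.mul_rpow_of_nonneg _ _ hpos.le, ← ENNReal.rpow_mul, ← ENNReal.rpow_mul,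
          mul_comm]
        congr 1
        · congr 1
          field_simp
        · rw [one_div_mul_cancel hpos.ne', ENNReal.rpow_one]

/-- Affine change of variables in a lower Lebesgue integral. -/
theorem lintegral_comp_add_smul {d : ℕ} {F : Esp d → ℝ≥0∞} (hF : Measurable F) (b : Esp d)
    {s : ℝ} (hs : 0 < s) :
    ∫⁻ x, F (b + s • x) = ENNReal.ofReal (s⁻¹ ^ d) * ∫⁻ x, F x := by
  have h1 : ∫⁻ x, F (b + s • x) = ∫⁻ y, F (b + y) ∂(Measure.map (s • ·) volume) := by
    rw [lintegral_map (by fun_prop) (by fun_prop)]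
  rw [h1, Measure.map_addHaar_smul _ hs.ne', lintegral_smul_measure, lintegral_add_left_eq_self F b]
  simp only [finrank_euclideanSpace, Fintype.card_fin, smul_eq_mul]
  rw [abs_of_pos (by positivity), inv_pow]

theorem lintegral_comp_add_smul_le {d : ℕ} {F : Esp d → ℝ≥0∞} (hF : Measurable F) (b : Esp d)
    {s : ℝ} (hs : 1 / 2 ≤ s) :
    ∫⁻ x, F (b + s • x) ≤ 2 ^ d * ∫⁻ x, F x := by
  have hs0 : 0 < s := by linarith
  rw [lintegral_comp_add_smul hF b hs0]
  gcongr
  have : s⁻¹ ≤ 2 := by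
    rw [inv_le_comm₀ hs0 two_pos]; linarith
  calc ENNReal.ofReal (s⁻¹ ^ d) ≤ ENNReal.ofReal (2 ^ d) := by gcongr
    _ = 2 ^ d := by rw [ENNReal.ofReal_pow zero_le_two]; simp

/-- The power weight `(x^1)^α`, as an extended nonnegative function. -/
def wgt (d : ℕ) [NeZero d] (α : ℝ) (x : Esp d) : ℝ≥0∞ := ENNReal.ofReal (x 0 ^ α)

theorem measurable_wgt (d : ℕ) [NeZero d] (α : ℝ) : Measurable (wgt d α) := by
  unfold wgt
  fun_prop

theorem wgt_le_mul {d : ℕ} [NeZero d] {α k : ℝ} (hα : 0 ≤ α) (hk : 0 ≤ k) {x z : Esp d}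
    (hx : 0 ≤ x 0) (hz : 0 ≤ z 0) (h : x 0 ≤ k * z 0) :
    wgt d α x ≤ ENNReal.ofReal (k ^ α) * wgt d α z := by
  unfold wgt
  rw [← ENNReal.ofReal_mul (by positivity), ← Real.mul_rpow hk hz]
  gcongr

/-- Weighted integrals along segments joining a convex set `S` of the half space to a subset `D`
lying at a height comparable to the maximal height of `S`. -/
theorem lintegral_segment_le {d : ℕ} [NeZero d] {α a : ℝ} (hα : 0 ≤ α)
    {S D : Set (Esp d)} (hSm : MeasurableSet S) (hDm : MeasurableSet D) (hDS : D ⊆ S)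
    (hS : ∀ x ∈ S, 0 < x 0 ∧ x 0 ≤ 2 * a) (hD : ∀ y ∈ D, a ≤ y 0)
    {V : ℝ≥0∞} (hSV : volume S ≤ V)
    {G : Esp d → ℝ≥0∞} (hG : Measurable G) (hG0 : ∀ x ∉ S, G x = 0) {s : ℝ}
    (hs : s ∈ Ioo (0 : ℝ) 1) :
    ∫⁻ x in S, ∫⁻ y in D, wgt d α x * G ((1 - s) • y + s • x) ≤
      ENNReal.ofReal (4 ^ α) * 2 ^ d * V * ∫⁻ x in S, wgt d α x * G x := by
  have hw := measurable_wgt d α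
  have hSint : ∫⁻ x in S, wgt d α x * G x = ∫⁻ x, wgt d α x * G x := by
    rw [← lintegral_indicator hSm]
    congr 1 with x
    by_cases hx : x ∈ S
    · simp [hx]
    · simp [hx, hG0 x hx]
  rw [hSint]
  have hDV : volume D ≤ V := (measure_mono hDS).trans hSV
  have hWG : Measurable fun x => wgt d α x * G x := hw.mul hG
  have hpt : ∀ x ∈ S, ∀ y ∈ D, wgt d α x * G ((1 - s) • y + s • x) ≤
      ENNReal.ofReal (4 ^ α) *
        (wgt d α ((1 - s) • y + s • x) * G ((1 - s) • y + s • x)) := by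
    intro x hx y hy
    by_cases hz : (1 - s) • y + s • x ∈ S
    swap
    · simp [hG0 _ hz]
    rw [← mul_assoc]
    gcongr
    obtain ⟨hx0, hxa⟩ := hS x hx
    have hy0 := hD y hy
    obtain ⟨hs0, hs1⟩ := hs
    refine wgt_le_mul hα (by norm_num) hx0.le (hS _ hz).1.le ?_
    simp only [PiLp.add_apply, PiLp.smul_apply, smul_eq_mul]
    have hya := (hS y (hDS hy)).2
    nlinarith
  have hb : ∫⁻ x in S, ∫⁻ y in D, wgt d α x * G ((1 - s) • y + s • x) ≤
      ENNReal.ofReal (4 ^ α) * ∫⁻ x in S, ∫⁻ y in D,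
        wgt d α ((1 - s) • y + s • x) * G ((1 - s) • y + s • x) := by
    rw [← lintegral_const_mul' _ _ ENNReal.ofReal_ne_top]
    refine setLIntegral_mono' hSm fun x hx => ?_
    rw [← lintegral_const_mul' _ _ ENNReal.ofReal_ne_top]
    exact setLIntegral_mono' hDm fun y hy => hpt x hx y hy
  refine hb.trans ?_
  rw [mul_assoc, mul_assoc]
  gcongr
  rcases le_total (1 / 2) s with h | h
  · rw [lintegral_lintegral_swap
      (by exact (hWG.comp (by fun_prop :
        Measurable fun q : Esp d × Esp d => (1 - s) • q.2 + s • q.1)).aemeasurable)]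
    calc _ ≤ ∫⁻ y in D, 2 ^ d * ∫⁻ x, wgt d α x * G x := by
          refine lintegral_mono fun y => ?_
          exact (setLIntegral_le_lintegral _ _).trans
            (lintegral_comp_add_smul_le hWG ((1 - s) • y) h)
      _ ≤ _ := by
        rw [lintegral_const, Measure.restrict_apply_univ]
        calc _ ≤ (2 ^ d * ∫⁻ x, wgt d α x * G x) * V := by gcongr
          _ = _ := by ring
  · calc _ ≤ ∫⁻ x in S, 2 ^ d * ∫⁻ x, wgt d α x * G x := by
          refine lintegral_mono fun x => ?_
          refine (setLIntegral_le_lintegral _ _).trans ?_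
          have := lintegral_comp_add_smul_le hWG (s • x) (s := 1 - s) (by linarith)
          simpa only [add_comm] using this
      _ ≤ _ := by
        rw [lintegral_const, Measure.restrict_apply_univ]
        calc _ ≤ (2 ^ d * ∫⁻ x, wgt d α x * G x) * V := by gcongr
          _ = _ := by ring

theorem isOpen_halfSp (d : ℕ) [NeZero d] : IsOpen (halfSp d) :=
  isOpen_lt continuous_const (by fun_prop)

/-- The increment of a `C¹` function along a segment is controlled by its gradient there. -/
theorem enorm_sub_le_lintegral_segment {E : Type*} [NormedAddCommGroup E] [NormedSpace ℝ E]
    {O : Set E} (hO : IsOpen O) {v : E → ℝ}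
    (hv : ContDiffOn ℝ 1 v O) {x y : E} (h : ∀ s ∈ Icc (0 : ℝ) 1, (1 - s) • y + s • x ∈ O) :
    ‖v x - v y‖ₑ ≤
      ∫⁻ s in Ioo (0 : ℝ) 1, ‖fderiv ℝ v ((1 - s) • y + s • x)‖ₑ * ‖x - y‖ₑ := by
  have hd : ∀ s ∈ uIcc (0 : ℝ) 1, HasDerivAt (fun s : ℝ => v ((1 - s) • y + s • x))
      (fderiv ℝ v ((1 - s) • y + s • x) (x - y)) s := by
    intro s hs
    rw [uIcc_of_le zero_le_one] at hs
    have h1 : HasFDerivAt v (fderiv ℝ v ((1 - s) • y + s • x)) ((1 - s) • y + s • x) :=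
      ((hv.differentiableOn (by norm_num)).differentiableAt (hO.mem_nhds (h s hs))).hasFDerivAt
    have h2 : HasDerivAt (fun s : ℝ => (1 - s) • y + s • x) (x - y) s := by
      have := (((hasDerivAt_id s).const_sub 1).smul_const y).add ((hasDerivAt_id s).smul_const x)
      convert this using 1
      · ext; simp
      · simp only [neg_smul, one_smul]; abel
    exact h1.comp_hasDerivAt s h2
  have hc : ContinuousOn (fun s : ℝ => fderiv ℝ v ((1 - s) • y + s • x) (x - y))
      (uIcc (0 : ℝ) 1) := by
    rw [uIcc_of_le zero_le_one]
    refine ContinuousOn.clm_apply ?_ continuousOn_const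
    exact (hv.continuousOn_fderiv_of_isOpen hO le_rfl).comp (by fun_prop) h
  have hft := intervalIntegral.integral_eq_sub_of_hasDerivAt hd hc.intervalIntegrable
  simp only [sub_self, zero_smul, one_smul, zero_add, sub_zero, add_zero] at hft
  rw [← hft, intervalIntegral.integral_of_le zero_le_one, integral_Ioc_eq_integral_Ioo]
  refine (enorm_integral_le_lintegral_enorm _).trans ?_
  exact lintegral_mono fun s => ContinuousLinearMap.le_opENorm _ _

theorem wgt_ne_top {d : ℕ} [NeZero d] (α : ℝ) (x : Esp d) : wgt d α x ≠ ∞ :=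
  ENNReal.ofReal_ne_top

/-- Weighted Poincaré inequality in double-integral form. -/
theorem lintegral_lintegral_sub_rpow_le {d : ℕ} [NeZero d] {α a p L : ℝ} (hα : 0 ≤ α)
    (hp : 1 ≤ p) {S D : Set (Esp d)} (hSm : MeasurableSet S) (hSc : Convex ℝ S)
    (hDm : MeasurableSet D)
    (hDS : D ⊆ S) (hS : ∀ x ∈ S, 0 < x 0 ∧ x 0 ≤ 2 * a) (hD : ∀ y ∈ D, a ≤ y 0)
    {V : ℝ≥0∞} (hSV : volume S ≤ V) (hL : ∀ x ∈ S, ∀ y ∈ S, ‖x - y‖ ≤ L)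
    {v : Esp d → ℝ} (hv : ContDiffOn ℝ 1 v (halfSp d)) :
    ∫⁻ x in S, wgt d α x * ∫⁻ y in D, ‖v x - v y‖ₑ ^ p ≤
      ENNReal.ofReal L ^ p * (ENNReal.ofReal (4 ^ α) * 2 ^ d * V) *
        ∫⁻ x in S, wgt d α x * ‖fderiv ℝ v x‖ₑ ^ p := by
  have hp0 : 0 ≤ p := by linarith
  have hw := measurable_wgt d α
  set G : Esp d → ℝ≥0∞ := S.indicator fun x => ‖fderiv ℝ v x‖ₑ ^ p with hGdef
  have hGm : Measurable G :=
    (((measurable_fderiv ℝ v).enorm).pow_const p).indicator hSm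
  have hG0 : ∀ x ∉ S, G x = 0 := fun x hx => by simp [hGdef, hx]
  have hGS : ∀ x ∈ S, G x = ‖fderiv ℝ v x‖ₑ ^ p := fun x hx => by simp [hGdef, hx]
  have hseg : ∀ x ∈ S, ∀ y ∈ D, ∀ s ∈ Icc (0 : ℝ) 1, (1 - s) • y + s • x ∈ S := by
    intro x hx y hy s hs
    exact hSc (hDS hy) hx (by linarith [hs.2]) hs.1 (by ring)
  have hpt : ∀ x ∈ S, ∀ y ∈ D, ‖v x - v y‖ₑ ^ p ≤
      ENNReal.ofReal L ^ p * ∫⁻ s in Ioo (0 : ℝ) 1, G ((1 - s) • y + s • x) := by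
    intro x hx y hy
    have hfm : Measurable fun s : ℝ =>
        ‖fderiv ℝ v ((1 - s) • y + s • x)‖ₑ * ‖x - y‖ₑ :=
      ((measurable_fderiv ℝ v).comp (by fun_prop)).enorm.mul_const _
    have h1 := enorm_sub_le_lintegral_segment (isOpen_halfSp d) hv (x := x) (y := y)
      fun s hs => (hS _ (hseg x hx y hy s hs)).1
    have h2 := lintegral_rpow_le_measure_mul (volume.restrict (Ioo (0 : ℝ) 1)) hp
      hfm.aemeasurable
    simp only [Measure.restrict_apply_univ, Real.volume_Ioo, sub_zero, ENNReal.ofReal_one,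
      ENNReal.one_rpow, one_mul] at h2
    refine (ENNReal.rpow_le_rpow h1 hp0).trans (h2.trans ?_)
    rw [← lintegral_const_mul' _ _ (ENNReal.rpow_ne_top_of_nonneg hp0 ENNReal.ofReal_ne_top)]
    refine setLIntegral_mono' measurableSet_Ioo fun s hs => ?_
    rw [hGS _ (hseg x hx y hy s (Ioo_subset_Icc_self hs)), ENNReal.mul_rpow_of_nonneg _ _ hp0,
      mul_comm]
    gcongr
    rw [← ofReal_norm]
    exact ENNReal.ofReal_le_ofReal (hL x hx y (hDS hy))
  have hI : ∫⁻ x in S, wgt d α x * ∫⁻ y in D, ‖v x - v y‖ₑ ^ p ≤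
      ENNReal.ofReal L ^ p * ∫⁻ x in S, ∫⁻ y in D, ∫⁻ s in Ioo (0 : ℝ) 1,
        wgt d α x * G ((1 - s) • y + s • x) := by
    rw [← lintegral_const_mul' _ _ (ENNReal.rpow_ne_top_of_nonneg hp0 ENNReal.ofReal_ne_top)]
    refine setLIntegral_mono' hSm fun x hx => ?_
    rw [← lintegral_const_mul' _ _ (ENNReal.rpow_ne_top_of_nonneg hp0 ENNReal.ofReal_ne_top),
      ← lintegral_const_mul' _ _ (wgt_ne_top α x)]
    refine setLIntegral_mono' hDm fun y hy => ?_
    rw [lintegral_const_mul' _ _ (wgt_ne_top α x), mul_left_comm]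
    gcongr
    exact hpt x hx y hy
  have hm3 : Measurable fun q : (Esp d × Esp d) × ℝ =>
      wgt d α q.1.1 * G ((1 - q.2) • q.1.2 + q.2 • q.1.1) :=
    (hw.comp (by fun_prop)).mul (hGm.comp (by fun_prop))
  have hswap : ∫⁻ x in S, ∫⁻ y in D, ∫⁻ s in Ioo (0 : ℝ) 1,
        wgt d α x * G ((1 - s) • y + s • x) =
      ∫⁻ s in Ioo (0 : ℝ) 1, ∫⁻ x in S, ∫⁻ y in D,
        wgt d α x * G ((1 - s) • y + s • x) := by
    have h1 : ∀ x, ∫⁻ y in D, ∫⁻ s in Ioo (0 : ℝ) 1,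
        wgt d α x * G ((1 - s) • y + s • x) = ∫⁻ s in Ioo (0 : ℝ) 1, ∫⁻ y in D,
        wgt d α x * G ((1 - s) • y + s • x) := fun x =>
      lintegral_lintegral_swap
        (hm3.comp (by fun_prop : Measurable fun q : Esp d × ℝ => ((x, q.1), q.2))).aemeasurable
    simp_rw [h1]
    refine lintegral_lintegral_swap (Measurable.aemeasurable ?_)
    exact Measurable.lintegral_prod_right'
      (hm3.comp (by fun_prop : Measurable fun q : (Esp d × ℝ) × Esp d =>
        ((q.1.1, q.2), q.1.2)))
  refine hI.trans ?_
  rw [hswap, mul_assoc]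
  gcongr
  calc _ ≤ ∫⁻ s in Ioo (0 : ℝ) 1, ENNReal.ofReal (4 ^ α) * 2 ^ d * V *
        ∫⁻ x in S, wgt d α x * G x := by
        refine setLIntegral_mono' measurableSet_Ioo fun s hs => ?_
        exact lintegral_segment_le hα hSm hDm hDS hS hD hSV hGm hG0 hs
    _ = ENNReal.ofReal (4 ^ α) * 2 ^ d * V * ∫⁻ x in S, wgt d α x * G x := by simp
    _ = _ := by
        congr 1
        exact setLIntegral_congr_fun hSm fun x hx => by simp only [hGS x hx]

/-- Weighted Poincaré inequality, the mean being taken against a density `ζ` supported in `D`. -/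
theorem lintegral_sub_mean_rpow_le {d : ℕ} [NeZero d] {α a p L : ℝ} (hα : 0 ≤ α)
    (hp : 1 ≤ p) {S D : Set (Esp d)} (hSm : MeasurableSet S) (hSc : Convex ℝ S)
    (hDm : MeasurableSet D)
    (hDS : D ⊆ S) (hS : ∀ x ∈ S, 0 < x 0 ∧ x 0 ≤ 2 * a) (hD : ∀ y ∈ D, a ≤ y 0)
    {V : ℝ≥0∞} (hSV : volume S ≤ V) (hL : ∀ x ∈ S, ∀ y ∈ S, ‖x - y‖ ≤ L)
    {v ζ : Esp d → ℝ} (hv : ContDiffOn ℝ 1 v (halfSp d)) (hζ : Integrable ζ)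
    (hζv : Integrable fun y => ζ y * v y) (hζ1 : ∫ y, ζ y = 1) (hζD : ∀ y ∉ D, ζ y = 0)
    {B : ℝ≥0∞} (hB : ∀ y, ‖ζ y‖ₑ ≤ B)
    (hBtop : B ≠ ∞) (hVtop : V ≠ ∞) :
    ∫⁻ x in S, wgt d α x * ‖v x - ∫ y, ζ y * v y‖ₑ ^ p ≤
      (B * V) ^ p * (ENNReal.ofReal L ^ p * (ENNReal.ofReal (4 ^ α) * 2 ^ d)) *
        ∫⁻ x in S, wgt d α x * ‖fderiv ℝ v x‖ₑ ^ p := by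
  have hp0 : 0 ≤ p := by linarith
  have hpt : ∀ x, ‖v x - ∫ y, ζ y * v y‖ₑ ^ p ≤
      B ^ p * V ^ (p - 1) * ∫⁻ y in D, ‖v x - v y‖ₑ ^ p := by
    intro x
    have h1 : v x - ∫ y, ζ y * v y = ∫ y, ζ y * (v x - v y) := by
      simp only [mul_sub]
      rw [integral_sub (hζ.mul_const _) hζv, integral_mul_const, hζ1, one_mul]
    have h2 : ‖v x - ∫ y, ζ y * v y‖ₑ ≤ ∫⁻ y in D, B * ‖v x - v y‖ₑ := by
      rw [h1]
      refine (enorm_integral_le_lintegral_enorm _).trans ?_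
      rw [← lintegral_indicator hDm]
      refine lintegral_mono fun y => ?_
      by_cases hy : y ∈ D
      · simp only [hy, indicator_of_mem, enorm_mul]
        gcongr
        exact hB y
      · simp [hζD y hy]
    have hm : AEMeasurable (fun y => B * ‖v x - v y‖ₑ) (volume.restrict D) := by
      have : ContinuousOn v D := hv.continuousOn.mono fun y hy => (hS y (hDS hy)).1
      exact ((aemeasurable_const.sub (this.aemeasurable hDm)).enorm).const_mul B
    have h3 := lintegral_rpow_le_measure_mul (volume.restrict D) hp hm
    refine (ENNReal.rpow_le_rpow h2 hp0).trans (h3.trans ?_)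
    rw [Measure.restrict_apply_univ]
    simp only [ENNReal.mul_rpow_of_nonneg _ _ hp0]
    have hm' : AEMeasurable (fun y => ‖v x - v y‖ₑ ^ p) (volume.restrict D) := by
      have : ContinuousOn v D := hv.continuousOn.mono fun y hy => (hS y (hDS hy)).1
      exact ((aemeasurable_const.sub (this.aemeasurable hDm)).enorm).pow_const p
    rw [lintegral_const_mul'' _ hm', ← mul_assoc, mul_comm (B ^ p)]
    gcongr
    exact (measure_mono hDS).trans hSV
  calc _ ≤ ∫⁻ x in S, B ^ p * V ^ (p - 1) * (wgt d α x * ∫⁻ y in D, ‖v x - v y‖ₑ ^ p) := by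
        refine lintegral_mono fun x => ?_
        rw [mul_left_comm]
        gcongr
        exact hpt x
    _ = B ^ p * V ^ (p - 1) * ∫⁻ x in S, wgt d α x * ∫⁻ y in D, ‖v x - v y‖ₑ ^ p := by
        rw [lintegral_const_mul' _ _ (ENNReal.mul_ne_top
          (ENNReal.rpow_ne_top_of_nonneg hp0 hBtop)
          (ENNReal.rpow_ne_top_of_nonneg (by linarith) hVtop))]
    _ ≤ B ^ p * V ^ (p - 1) * (ENNReal.ofReal L ^ p * (ENNReal.ofReal (4 ^ α) * 2 ^ d * V) *
        ∫⁻ x in S, wgt d α x * ‖fderiv ℝ v x‖ₑ ^ p) := by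
        gcongr
        exact lintegral_lintegral_sub_rpow_le hα hp hSm hSc hDm hDS hS hD hSV hL hv
    _ = _ := by
        have hV : V ^ p = V ^ (p - 1) * V := by
          conv_rhs => rw [← ENNReal.rpow_one V, ← ENNReal.rpow_mul, one_mul]
          rw [← ENNReal.rpow_add_of_nonneg _ _ (by linarith) zero_le_one]
          simp
        rw [ENNReal.mul_rpow_of_nonneg _ _ hp0, hV]
        ring

/-- Normalised bump functions at scale `r`, with scale-invariant bounds. -/
theorem exists_scaled_bump (d : ℕ) : ∃ M : ℝ, 0 < M ∧ ∀ (c : Esp d) (r : ℝ), 0 < r →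
    ∃ ζ : Esp d → ℝ, ContDiff ℝ (⊤ : ℕ∞) ζ ∧ tsupport ζ ⊆ Metric.closedBall c (r / 4) ∧
      ∫ y, ζ y = 1 ∧ (∀ y, |ζ y| ≤ M / r ^ d) ∧ ∀ y, ‖fderiv ℝ ζ y‖ ≤ M / (r * r ^ d) := by
  let φ : ContDiffBump (0 : Esp d) := ⟨1 / 8, 1 / 4, by norm_num, by norm_num⟩
  set ψ : Esp d → ℝ := φ.normed volume with hψ
  have hψc : ContDiff ℝ (⊤ : ℕ∞) ψ := φ.contDiff_normed
  have hψs : HasCompactSupport ψ := φ.hasCompactSupport_normed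
  obtain ⟨M₀, hM₀⟩ := hψs.exists_bound_of_continuous hψc.continuous
  obtain ⟨M₁, hM₁⟩ := (hψs.fderiv ℝ).exists_bound_of_continuous
    (hψc.continuous_fderiv (by simp))
  refine ⟨max (max M₀ M₁) 1, by positivity, fun c r hr => ?_⟩
  refine ⟨fun y => (r ^ d)⁻¹ * ψ (r⁻¹ • (y - c)), ?_, ?_, ?_, ?_, ?_⟩
  · exact contDiff_const.mul (hψc.comp (by fun_prop))
  · refine closure_minimal ?_ Metric.isClosed_closedBall
    intro y hy
    have h1 : r⁻¹ • (y - c) ∈ Function.support ψ := by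
      intro h
      simp [h] at hy
    rw [hψ, φ.support_normed_eq, mem_ball_zero_iff, norm_smul, norm_inv, Real.norm_of_nonneg hr.le,
      inv_mul_lt_iff₀ hr] at h1
    rw [mem_closedBall_iff_norm]
    change ‖y - c‖ < r * (1 / 4) at h1
    linarith
  · rw [integral_const_mul, integral_sub_right_eq_self (fun y => ψ (r⁻¹ • y)) c,
      Measure.integral_comp_inv_smul, hψ, φ.integral_normed]
    simp only [finrank_euclideanSpace, Fintype.card_fin, smul_eq_mul, mul_one]
    rw [abs_of_pos (by positivity), inv_mul_cancel₀ (by positivity)]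
  · intro y
    rw [abs_mul, abs_of_pos (by positivity), div_eq_inv_mul]
    gcongr
    exact (hM₀ _).trans ((le_max_left _ _).trans (le_max_left _ _))
  · intro y
    have h1 : HasFDerivAt (fun y => (r ^ d)⁻¹ * ψ (r⁻¹ • (y - c)))
        ((r ^ d)⁻¹ • (fderiv ℝ ψ (r⁻¹ • (y - c))).comp
          (r⁻¹ • ContinuousLinearMap.id ℝ (Esp d))) y := by
      refine HasFDerivAt.const_mul ?_ _
      refine HasFDerivAt.comp y
        ((hψc.differentiable (by simp)).differentiableAt.hasFDerivAt) ?_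
      exact ((hasFDerivAt_id y).sub_const c).const_smul r⁻¹
    rw [h1.fderiv, norm_smul, norm_inv, Real.norm_of_nonneg (by positivity)]
    have h2 : ‖(fderiv ℝ ψ (r⁻¹ • (y - c))).comp (r⁻¹ • ContinuousLinearMap.id ℝ (Esp d))‖ ≤
        max (max M₀ M₁) 1 * r⁻¹ := by
      refine (ContinuousLinearMap.opNorm_comp_le _ _).trans ?_
      gcongr
      · exact (hM₁ _).trans ((le_max_right _ _).trans (le_max_left _ _))
      · rw [norm_smul, norm_inv, Real.norm_of_nonneg hr.le]
        exact mul_le_of_le_one_right (by positivity) ContinuousLinearMap.norm_id_le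
    calc _ ≤ (r ^ d)⁻¹ * (max (max M₀ M₁) 1 * r⁻¹) := by gcongr
      _ = _ := by field_simp

theorem isOpen_halfST (d : ℕ) [NeZero d] : IsOpen (halfST d) :=
  isOpen_lt continuous_const (by fun_prop)

section Slices

variable {d : ℕ} [NeZero d] {φ : ℝ × Esp d → ℝ}

theorem ContDiffOn.hasFDerivAt_halfST (hφ : ContDiffOn ℝ (⊤ : ℕ∞) φ (halfST d)) {z : ℝ × Esp d}
    (hz : z ∈ halfST d) : HasFDerivAt φ (fderiv ℝ φ z) z :=
  ((hφ.differentiableOn (by simp)).differentiableAt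
    ((isOpen_halfST d).mem_nhds hz)).hasFDerivAt

theorem hasFDerivAt_space_slice (hφ : ContDiffOn ℝ (⊤ : ℕ∞) φ (halfST d)) {z : ℝ × Esp d}
    (hz : z ∈ halfST d) : HasFDerivAt (fun y => φ (z.1, y))
      ((fderiv ℝ φ z).comp (ContinuousLinearMap.inr ℝ ℝ (Esp d))) z.2 :=
  (hφ.hasFDerivAt_halfST hz).comp z.2 (hasFDerivAt_prodMk_right z.1 z.2)

theorem hasDerivAt_time_slice (hφ : ContDiffOn ℝ (⊤ : ℕ∞) φ (halfST d)) {z : ℝ × Esp d}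
    (hz : z ∈ halfST d) : HasDerivAt (fun s => φ (s, z.2)) (fderiv ℝ φ z (1, 0)) z.1 :=
  HasFDerivAt.comp_hasDerivAt (f := fun s => (s, z.2)) z.1 (hφ.hasFDerivAt_halfST hz)
    ((hasDerivAt_id z.1).prodMk (hasDerivAt_const z.1 z.2))

theorem psp_eq_fderiv (hφ : ContDiffOn ℝ (⊤ : ℕ∞) φ (halfST d)) (i : Fin d) {z : ℝ × Esp d}
    (hz : z ∈ halfST d) : psp d i φ z = fderiv ℝ φ z (0, EuclideanSpace.single i 1) := by
  rw [psp, (hasFDerivAt_space_slice hφ hz).fderiv]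
  simp

theorem ptime_eq_fderiv (hφ : ContDiffOn ℝ (⊤ : ℕ∞) φ (halfST d)) {z : ℝ × Esp d}
    (hz : z ∈ halfST d) : ptime d φ z = fderiv ℝ φ z (1, 0) :=
  (hasDerivAt_time_slice hφ hz).deriv

theorem contDiffOn_fderiv_apply (hφ : ContDiffOn ℝ (⊤ : ℕ∞) φ (halfST d)) (e : ℝ × Esp d) :
    ContDiffOn ℝ (⊤ : ℕ∞) (fun z => fderiv ℝ φ z e) (halfST d) :=
  (hφ.fderiv_of_isOpen (isOpen_halfST d) (by simp)).clm_apply contDiffOn_const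

theorem contDiffOn_psp (hφ : ContDiffOn ℝ (⊤ : ℕ∞) φ (halfST d)) (i : Fin d) :
    ContDiffOn ℝ (⊤ : ℕ∞) (psp d i φ) (halfST d) :=
  (contDiffOn_fderiv_apply hφ _).congr fun _ hz => psp_eq_fderiv hφ i hz

theorem contDiffOn_ptime (hφ : ContDiffOn ℝ (⊤ : ℕ∞) φ (halfST d)) :
    ContDiffOn ℝ (⊤ : ℕ∞) (ptime d φ) (halfST d) :=
  (contDiffOn_fderiv_apply hφ _).congr fun _ hz => ptime_eq_fderiv hφ hz

theorem continuousOn_gradNorm (hφ : ContDiffOn ℝ (⊤ : ℕ∞) φ (halfST d)) :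
    ContinuousOn (gradNorm d φ) (halfST d) := by
  have h : ContinuousOn (fun z => ‖(fderiv ℝ φ z).comp (ContinuousLinearMap.inr ℝ ℝ (Esp d))‖)
      (halfST d) :=
    ((hφ.continuousOn_fderiv_of_isOpen (isOpen_halfST d) (by simp)).clm_comp
      continuousOn_const).norm
  exact h.congr fun z hz => by rw [gradNorm, (hasFDerivAt_space_slice hφ hz).fderiv]

theorem contDiffOn_space_slice (hφ : ContDiffOn ℝ (⊤ : ℕ∞) φ (halfST d)) (t : ℝ) :
    ContDiffOn ℝ (⊤ : ℕ∞) (fun y => φ (t, y)) (halfSp d) :=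
  hφ.comp (contDiff_const.prodMk contDiff_id).contDiffOn fun _ hy => hy

theorem psp_psp_comm (hφ : ContDiffOn ℝ (⊤ : ℕ∞) φ (halfST d)) (i j : Fin d) {z : ℝ × Esp d}
    (hz : z ∈ halfST d) : psp d i (psp d j φ) z = psp d j (psp d i φ) z := by
  have key : ∀ i j : Fin d, psp d i (psp d j φ) z =
      fderiv ℝ (fderiv ℝ φ) z (0, EuclideanSpace.single i 1) (0, EuclideanSpace.single j 1) := by
    intro i j
    rw [psp_eq_fderiv (contDiffOn_psp hφ j) i hz]
    have h1 : psp d j φ =ᶠ[nhds z] fun w => fderiv ℝ φ w (0, EuclideanSpace.single j 1) := by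
      filter_upwards [(isOpen_halfST d).mem_nhds hz] with w hw using psp_eq_fderiv hφ j hw
    have h2 : DifferentiableAt ℝ (fderiv ℝ φ) z :=
      ((hφ.fderiv_of_isOpen (m := 1) (isOpen_halfST d) (by norm_cast)).differentiableOn
        (by simp)).differentiableAt ((isOpen_halfST d).mem_nhds hz)
    rw [h1.fderiv_eq, fderiv_clm_apply h2 (differentiableAt_const _)]
    simp
  rw [key, key]
  have hc : ContDiffAt ℝ (⊤ : ℕ∞) φ z := hφ.contDiffAt ((isOpen_halfST d).mem_nhds hz)
  have h2 : (2 : WithTop ℕ∞) ≤ ((⊤ : ℕ∞) : WithTop ℕ∞) := WithTop.coe_le_coe.2 le_top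
  exact (hc.isSymmSndFDerivAt (by simpa using h2)).eq _ _

end Slices

section Cutoff

variable {d : ℕ} [NeZero d] {φ : ℝ × Esp d → ℝ} {ζ : Esp d → ℝ}

theorem continuous_cutoff_mul (hζ : Continuous ζ) (hs : tsupport ζ ⊆ halfSp d)
    (hφ : ContinuousOn φ (halfST d)) : Continuous fun z : ℝ × Esp d => ζ z.2 * φ z := by
  rw [continuous_iff_continuousAt]
  intro z
  by_cases hz : z.2 ∈ halfSp d
  · exact (hζ.comp continuous_snd).continuousAt.mul
      (hφ.continuousAt ((isOpen_halfST d).mem_nhds hz))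
  · have h1 : ζ =ᶠ[nhds z.2] 0 := notMem_tsupport_iff_eventuallyEq.1 fun h => hz (hs h)
    have h2 : (fun z : ℝ × Esp d => ζ z.2 * φ z) =ᶠ[nhds z] fun _ => 0 := by
      filter_upwards [continuous_snd.continuousAt.eventually h1] with w hw
      simp [hw]
    exact continuousAt_const.congr h2.symm

theorem integrable_cutoff_mul (hζ : Continuous ζ) (hs : tsupport ζ ⊆ halfSp d)
    (hζc : HasCompactSupport ζ) (hφ : ContinuousOn φ (halfST d)) (t : ℝ) :
    Integrable fun y => ζ y * φ (t, y) :=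
  ((continuous_cutoff_mul hζ hs hφ).comp (by fun_prop :
    Continuous fun y : Esp d => (t, y))).integrable_of_hasCompactSupport hζc.mul_right

/-- Integration by parts against a cutoff supported in the open half space. -/
theorem integral_cutoff_mul_psp (hζ : ContDiff ℝ (⊤ : ℕ∞) ζ) (hs : tsupport ζ ⊆ halfSp d)
    (hζc : HasCompactSupport ζ) (hφ : ContDiffOn ℝ (⊤ : ℕ∞) φ (halfST d)) (i : Fin d) (t : ℝ) :
    ∫ y, ζ y * psp d i φ (t, y) =
      -∫ y, fderiv ℝ ζ y (EuclideanSpace.single i 1) * φ (t, y) := by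
  set e : Esp d := EuclideanSpace.single i 1 with he
  set F : Esp d → ℝ := fun y => ζ y * φ (t, y) with hF
  have hs' : tsupport (fun y => fderiv ℝ ζ y e) ⊆ tsupport ζ :=
    tsupport_fderiv_apply_subset ℝ e
  have hc' : HasCompactSupport fun y => fderiv ℝ ζ y e := hζc.fderiv_apply ℝ e
  have hζ' : Continuous fun y => fderiv ℝ ζ y e :=
    (hζ.continuous_fderiv (by simp)).clm_apply continuous_const
  have hd : ∀ y, DifferentiableAt ℝ F y ∧
      fderiv ℝ F y e = ζ y * psp d i φ (t, y) + fderiv ℝ ζ y e * φ (t, y) := by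
    intro y
    by_cases hy : y ∈ halfSp d
    · have h1 := (hζ.differentiable (by simp)).differentiableAt.hasFDerivAt (x := y)
      have h2 := hasFDerivAt_space_slice hφ (z := (t, y)) hy
      have h3 := h1.mul h2
      refine ⟨h3.differentiableAt, ?_⟩
      have h4 : fderiv ℝ F y = _ := h3.fderiv
      rw [h4, psp, h2.fderiv]
      simp only [add_apply, smul_apply, smul_eq_mul, he]
      ring
    · have hyt : y ∉ tsupport ζ := fun h => hy (hs h)
      have h1 : ζ =ᶠ[nhds y] 0 := notMem_tsupport_iff_eventuallyEq.1 hyt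
      have h2 : F =ᶠ[nhds y] fun _ => 0 := by
        filter_upwards [h1] with w hw
        simp [hF, hw]
      refine ⟨(differentiableAt_const _).congr_of_eventuallyEq h2, ?_⟩
      rw [h2.fderiv_eq, h1.fderiv_eq, h1.eq_of_nhds]
      simp
  have i1 : Integrable fun y => ζ y * psp d i φ (t, y) :=
    integrable_cutoff_mul hζ.continuous hs hζc (contDiffOn_psp hφ i).continuousOn t
  have i2 : Integrable fun y => fderiv ℝ ζ y e * φ (t, y) :=
    integrable_cutoff_mul hζ' (hs'.trans hs) hc' hφ.continuousOn t
  have i3 : Integrable F := integrable_cutoff_mul hζ.continuous hs hζc hφ.continuousOn t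
  have i4 : Integrable fun y => fderiv ℝ F y e := by
    simp_rw [fun y => (hd y).2]
    exact i1.add i2
  have h := integral_mul_fderiv_eq_neg_fderiv_mul_of_integrable (𝕜 := ℝ) (μ := volume)
    (f := fun _ : Esp d => (1 : ℝ)) (g := F) (v := e) (by simp) (by simpa using i4)
    (by simpa using i3) (fun _ _ => differentiableAt_const _)
    fun y _ => (hd y).1
  simp only [one_mul, fderiv_fun_const, Pi.zero_apply, zero_apply, zero_mul,
    integral_zero, neg_zero] at h
  simp_rw [fun y => (hd y).2] at h
  rw [integral_add i1 i2] at h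
  linarith

/-- The increment in time of a mean over a cutoff. -/
theorem integral_cutoff_sub (hζ : Continuous ζ) (hs : tsupport ζ ⊆ halfSp d)
    (hζc : HasCompactSupport ζ) (hφ : ContDiffOn ℝ (⊤ : ℕ∞) φ (halfST d)) {s t : ℝ} (hst : s ≤ t) :
    (∫ y, ζ y * φ (t, y)) - ∫ y, ζ y * φ (s, y) =
      ∫ τ in Ioc s t, ∫ y, ζ y * ptime d φ (τ, y) := by
  have hk := continuous_cutoff_mul hζ hs (contDiffOn_ptime hφ).continuousOn
  rw [← integral_sub (integrable_cutoff_mul hζ hs hζc hφ.continuousOn t)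
    (integrable_cutoff_mul hζ hs hζc hφ.continuousOn s), integral_integral_swap]
  · congr 1 with y
    rw [← intervalIntegral.integral_of_le hst]
    by_cases hy : y ∈ halfSp d
    · symm
      refine intervalIntegral.integral_eq_sub_of_hasDerivAt (f := fun τ => ζ y * φ (τ, y)) ?_ ?_
      · intro τ _
        have := hasDerivAt_time_slice hφ (z := (τ, y)) hy
        rw [← ptime_eq_fderiv hφ (z := (τ, y)) hy] at this
        exact this.const_mul (ζ y)
      · exact (hk.comp (by fun_prop : Continuous fun τ : ℝ => (τ, y))).intervalIntegrable _ _
    · have h0 : ζ y = 0 := image_eq_zero_of_notMem_tsupport fun h => hy (hs h)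
      simp [h0]
  · have h1 : IntegrableOn (fun z : ℝ × Esp d => ζ z.2 * ptime d φ z)
        (Icc s t ×ˢ tsupport ζ) (volume.prod volume) :=
      hk.continuousOn.integrableOn_compact (isCompact_Icc.prod hζc)
    have h2 : Measure.prod (volume.restrict (Ioc s t)) (volume : Measure (Esp d)) =
        (volume.prod volume).restrict (Ioc s t ×ˢ univ) := by
      rw [← Measure.prod_restrict, Measure.restrict_univ]
    rw [h2]
    change IntegrableOn (fun z : ℝ × Esp d => ζ z.2 * ptime d φ z) _ _
    have h3 : IntegrableOn (fun z : ℝ × Esp d => ζ z.2 * ptime d φ z)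
        (Icc s t ×ˢ univ) (volume.prod volume) := by
      refine h1.of_forall_sdiff_eq_zero (measurableSet_Icc.prod MeasurableSet.univ) ?_
      rintro ⟨τ, y⟩ ⟨h, h'⟩
      have : y ∉ tsupport ζ := fun hy => h' ⟨h.1, hy⟩
      simp [image_eq_zero_of_notMem_tsupport this]
    exact h3.mono_set (prod_mono Ioc_subset_Icc_self subset_rfl)

end Cutoff

/-- The symmetric part of an elliptic matrix has entries bounded by the upper ellipticity constant. -/
theorem ellipT.abs_symm_le {d : ℕ} {A : ℝ → Fin d → Fin d → ℝ} {δ K : ℝ} (hA : ellipT d A δ K)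
    (hδ : 0 < δ) (t : ℝ) (i j : Fin d) : |(A t i j + A t j i) / 2| ≤ K := by
  have hq : ∀ (x y : ℝ), i ≠ j → ∑ k, ∑ l, A t k l *
      (Pi.single i x + Pi.single j y : Fin d → ℝ) k *
      (Pi.single i x + Pi.single j y : Fin d → ℝ) l =
      A t i i * x * x + A t j j * y * y + (A t i j + A t j i) * x * y := by
    intro x y hij
    simp only [Pi.add_apply, mul_add, add_mul, Finset.sum_add_distrib, Pi.single_apply, mul_ite,
      mul_zero, ite_mul, zero_mul, Finset.sum_ite_eq', Finset.mem_univ, if_true]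
    ring
  have hn : ∀ (x y : ℝ), i ≠ j →
      ∑ k, (Pi.single i x + Pi.single j y : Fin d → ℝ) k ^ 2 = x ^ 2 + y ^ 2 := by
    intro x y hij
    simp only [Pi.add_apply, sq, mul_add, add_mul, Finset.sum_add_distrib, Pi.single_apply,
      mul_ite, mul_zero, ite_mul, zero_mul, Finset.sum_ite_eq', Finset.mem_univ, if_true,
      hij, hij.symm, if_false]
    ring
  rcases eq_or_ne i j with rfl | hij
  · have h := hA t (Pi.single i 1)
    simp only [Pi.single_apply, ite_pow, one_pow, ne_eq, OfNat.ofNat_ne_zero, not_false_eq_true,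
      zero_pow, Finset.sum_ite_eq', Finset.mem_univ, if_true, mul_ite, mul_one, mul_zero] at h
    rw [abs_le]
    constructor <;> linarith [h.1, h.2]
  · have h1 := hA t (Pi.single i 1 + Pi.single j 1)
    have h2 := hA t (Pi.single i 1 + Pi.single j (-1))
    rw [hq _ _ hij, hn _ _ hij] at h1 h2
    rw [abs_le]
    constructor <;> linarith [h1.1, h1.2, h2.1, h2.2]

section TimeIncrement

variable {d : ℕ} [NeZero d] {A : ℝ → Fin d → Fin d → ℝ} {δ K : ℝ}
  {u g : ℝ × Esp d → ℝ} {fv : Fin d → ℝ × Esp d → ℝ} {ζ : Esp d → ℝ}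

theorem sum_coeff_symm (hu : ContDiffOn ℝ (⊤ : ℕ∞) u (halfST d)) {z : ℝ × Esp d}
    (hz : z ∈ halfST d) (t : ℝ) :
    ∑ i, ∑ j, A t i j * psp d i (psp d j u) z =
      ∑ i, ∑ j, (A t i j + A t j i) / 2 * psp d i (psp d j u) z := by
  have h : ∑ i, ∑ j, A t i j * psp d i (psp d j u) z =
      ∑ i, ∑ j, A t j i * psp d i (psp d j u) z := by
    rw [Finset.sum_comm]
    exact Finset.sum_congr rfl fun i _ => Finset.sum_congr rfl fun j _ => by
      rw [psp_psp_comm hu j i hz]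
  have h2 : ∀ i j, (A t i j + A t j i) / 2 * psp d i (psp d j u) z =
      (A t i j * psp d i (psp d j u) z) / 2 + (A t j i * psp d i (psp d j u) z) / 2 :=
    fun i j => by ring
  simp only [h2, Finset.sum_add_distrib, ← Finset.sum_div]
  linarith

/-- The time derivative of a mean over a cutoff, after integration by parts in space. -/
theorem integral_cutoff_mul_ptime (hζ : ContDiff ℝ (⊤ : ℕ∞) ζ) (hs : tsupport ζ ⊆ halfSp d)
    (hζc : HasCompactSupport ζ) (hu : ContDiffOn ℝ (⊤ : ℕ∞) u (halfST d))
    (hg : ContDiffOn ℝ (⊤ : ℕ∞) g (halfST d))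
    (hf : ∀ i, ContDiffOn ℝ (⊤ : ℕ∞) (fv i) (halfST d)) {τ : ℝ}
    (heq : ∀ y ∈ tsupport ζ,
      ptime d u (τ, y) + ∑ i, ∑ j, A τ i j * psp d i (psp d j u) (τ, y)
        = (∑ i, psp d i (fv i) (τ, y)) + g (τ, y)) :
    ∫ y, ζ y * ptime d u (τ, y) =
      ∫ y, ((∑ i, ∑ j, (A τ i j + A τ j i) / 2 *
          (fderiv ℝ ζ y (EuclideanSpace.single i 1) * psp d j u (τ, y)))
        - (∑ i, fderiv ℝ ζ y (EuclideanSpace.single i 1) * fv i (τ, y)) + ζ y * g (τ, y)) := by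
  have hpw : ∀ y, ζ y * ptime d u (τ, y) =
      -(∑ i, ∑ j, (A τ i j + A τ j i) / 2 * (ζ y * psp d i (psp d j u) (τ, y)))
        + (∑ i, ζ y * psp d i (fv i) (τ, y)) + ζ y * g (τ, y) := by
    intro y
    by_cases hy : y ∈ tsupport ζ
    · have h1 := heq y hy
      rw [sum_coeff_symm hu (z := (τ, y)) (hs hy)] at h1
      have h2 : ∑ i, ∑ j, (A τ i j + A τ j i) / 2 * (ζ y * psp d i (psp d j u) (τ, y)) =
          ζ y * ∑ i, ∑ j, (A τ i j + A τ j i) / 2 * psp d i (psp d j u) (τ, y) := by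
        simp only [Finset.mul_sum]
        exact Finset.sum_congr rfl fun i _ => Finset.sum_congr rfl fun j _ => by ring
      rw [h2, ← Finset.mul_sum]
      linear_combination ζ y * h1
    · simp [image_eq_zero_of_notMem_tsupport hy]
  have hs' : ∀ e, tsupport (fun y => fderiv ℝ ζ y e) ⊆ halfSp d := fun e =>
    (tsupport_fderiv_apply_subset ℝ e).trans hs
  have hc' : ∀ e, HasCompactSupport fun y => fderiv ℝ ζ y e := fun e => hζc.fderiv_apply ℝ e
  have hζ' : ∀ e, Continuous fun y => fderiv ℝ ζ y e := fun e =>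
    (hζ.continuous_fderiv (by simp)).clm_apply continuous_const
  have i1 : ∀ i j, Integrable fun y => (A τ i j + A τ j i) / 2 *
      (ζ y * psp d i (psp d j u) (τ, y)) := fun i j =>
    (integrable_cutoff_mul hζ.continuous hs hζc
      (contDiffOn_psp (contDiffOn_psp hu j) i).continuousOn τ).const_mul _
  have i2 : ∀ i, Integrable fun y => ζ y * psp d i (fv i) (τ, y) := fun i =>
    integrable_cutoff_mul hζ.continuous hs hζc (contDiffOn_psp (hf i) i).continuousOn τ
  have i3 : Integrable fun y => ζ y * g (τ, y) :=
    integrable_cutoff_mul hζ.continuous hs hζc hg.continuousOn τ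
  have i4 : ∀ i j, Integrable fun y => (A τ i j + A τ j i) / 2 *
      (fderiv ℝ ζ y (EuclideanSpace.single i 1) * psp d j u (τ, y)) := fun i j =>
    (integrable_cutoff_mul (hζ' _) (hs' _) (hc' _)
      (contDiffOn_psp hu j).continuousOn τ).const_mul _
  have i5 : ∀ i, Integrable fun y => fderiv ℝ ζ y (EuclideanSpace.single i 1) * fv i (τ, y) :=
    fun i => integrable_cutoff_mul (hζ' _) (hs' _) (hc' _) (hf i).continuousOn τ
  have j1 := integrable_finsetSum Finset.univ fun i _ =>
    integrable_finsetSum Finset.univ fun j _ => i1 i j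
  have j2 := integrable_finsetSum Finset.univ fun i _ => i2 i
  have j4 := integrable_finsetSum Finset.univ fun i _ =>
    integrable_finsetSum Finset.univ fun j _ => i4 i j
  have j5 := integrable_finsetSum Finset.univ fun i _ => i5 i
  simp_rw [hpw]
  rw [integral_add (j1.fun_neg.fun_add j2) i3, integral_add j1.fun_neg j2, integral_neg,
    integral_add (by exact j4.sub j5) i3, integral_sub j4 j5,
    integral_finsetSum _ fun i _ => i2 i, integral_finsetSum _ fun i _ => i5 i,
    integral_finsetSum _ fun i _ => integrable_finsetSum Finset.univ fun j _ => i1 i j,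
    integral_finsetSum _ fun i _ => integrable_finsetSum Finset.univ fun j _ => i4 i j]
  simp_rw [fun i => integral_finsetSum Finset.univ fun j _ => i1 i j,
    fun i => integral_finsetSum Finset.univ fun j _ => i4 i j, integral_const_mul,
    fun i j => integral_cutoff_mul_psp hζ hs hζc (contDiffOn_psp hu j) i τ,
    fun i => integral_cutoff_mul_psp hζ hs hζc (hf i) i τ]
  simp only [mul_neg, Finset.sum_neg_distrib, neg_neg]
  ring

theorem abs_cutoff_flux_le {z : ℝ × Esp d} {a : Fin d → Fin d → ℝ} {L : Esp d →L[ℝ] ℝ} {m b r : ℝ}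
    (hK : 0 ≤ K) (ha : ∀ i j, |a i j| ≤ K) (hL : ‖L‖ ≤ b) (hr : 0 ≤ r) (hm : |m| ≤ b * r) :
    |(∑ i, ∑ j, a i j * (L (EuclideanSpace.single i 1) * psp d j u z))
        - (∑ i, L (EuclideanSpace.single i 1) * fv i z) + m * g z| ≤
      b * ((d : ℝ) ^ 2 * K + d + 1) *
        (gradNorm d u z + Real.sqrt (∑ i, fv i z ^ 2) + r * |g z|) := by
  have hb : 0 ≤ b := (norm_nonneg _).trans hL
  have hLi : ∀ i, |L (EuclideanSpace.single i 1)| ≤ b := fun i => by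
    have := L.le_opNorm (EuclideanSpace.single i 1)
    simp only [PiLp.norm_single, norm_one, mul_one, Real.norm_eq_abs] at this
    exact this.trans hL
  have hui : ∀ j, |psp d j u z| ≤ gradNorm d u z := fun j => by
    have := (fderiv ℝ (fun y => u (z.1, y)) z.2).le_opNorm (EuclideanSpace.single j 1)
    simpa [psp, gradNorm] using this
  have hfi : ∀ i, |fv i z| ≤ Real.sqrt (∑ i, fv i z ^ 2) := fun i => by
    rw [← Real.sqrt_sq_eq_abs]
    exact Real.sqrt_le_sqrt (Finset.single_le_sum (f := fun i => fv i z ^ 2)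
      (fun _ _ => sq_nonneg _) (Finset.mem_univ i))
  set G := gradNorm d u z
  set R := Real.sqrt (∑ i, fv i z ^ 2)
  have hG : 0 ≤ G := norm_nonneg _
  have hR : 0 ≤ R := Real.sqrt_nonneg _
  have h1 : |∑ i, ∑ j, a i j * (L (EuclideanSpace.single i 1) * psp d j u z)| ≤
      (d : ℝ) ^ 2 * (K * (b * G)) := by
    calc _ ≤ ∑ i : Fin d, ∑ j : Fin d, K * (b * G) := by
          refine (Finset.abs_sum_le_sum_abs _ _).trans (Finset.sum_le_sum fun i _ => ?_)
          refine (Finset.abs_sum_le_sum_abs _ _).trans (Finset.sum_le_sum fun j _ => ?_)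
          rw [abs_mul, abs_mul]
          gcongr
          exacts [ha i j, hLi i, hui j]
      _ = _ := by simp; ring
  have h2 : |∑ i, L (EuclideanSpace.single i 1) * fv i z| ≤ d * (b * R) := by
    calc _ ≤ ∑ i : Fin d, b * R := by
          refine (Finset.abs_sum_le_sum_abs _ _).trans (Finset.sum_le_sum fun i _ => ?_)
          rw [abs_mul]
          gcongr
          exacts [hLi i, hfi i]
      _ = _ := by simp
  have h3 : |m * g z| ≤ b * r * |g z| := by
    rw [abs_mul]; gcongr
  have h4 : 0 ≤ r * |g z| := by positivity
  calc _ ≤ (d : ℝ) ^ 2 * (K * (b * G)) + d * (b * R) + b * r * |g z| :=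
        (abs_add_le _ _).trans (add_le_add ((abs_sub _ _).trans (add_le_add h1 h2)) h3)
    _ ≤ _ := by
      have e : b * ((d : ℝ) ^ 2 * K + d + 1) * (G + R + r * |g z|) -
          ((d : ℝ) ^ 2 * (K * (b * G)) + d * (b * R) + b * r * |g z|) =
          b * ((d : ℝ) ^ 2 * K * (R + r * |g z|) + d * (G + r * |g z|) + (G + R)) := by ring
      have : 0 ≤ b * ((d : ℝ) ^ 2 * K * (R + r * |g z|) + d * (G + r * |g z|) + (G + R)) := by
        positivity
      linarith

/-- Oscillation in time of the mean of a solution over a cutoff. -/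
theorem enorm_integral_cutoff_sub_le (hζ : ContDiff ℝ (⊤ : ℕ∞) ζ) (hζc : HasCompactSupport ζ)
    {D : Set (Esp d)} (hDm : MeasurableSet D) (hD : D ⊆ halfSp d) (hs : tsupport ζ ⊆ D)
    (hu : ContDiffOn ℝ (⊤ : ℕ∞) u (halfST d)) (hg : ContDiffOn ℝ (⊤ : ℕ∞) g (halfST d))
    (hf : ∀ i, ContDiffOn ℝ (⊤ : ℕ∞) (fv i) (halfST d)) (hA : ellipT d A δ K) (hδ : 0 < δ)
    (hK : 0 ≤ K) {b r T : ℝ} (hr : 0 ≤ r) (hb : ∀ y, ‖fderiv ℝ ζ y‖ ≤ b)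
    (hb' : ∀ y, |ζ y| ≤ b * r)
    (heq : ∀ τ ∈ Ioo 0 T, ∀ y ∈ D,
      ptime d u (τ, y) + ∑ i, ∑ j, A τ i j * psp d i (psp d j u) (τ, y)
        = (∑ i, psp d i (fv i) (τ, y)) + g (τ, y))
    {s t : ℝ} (hs0 : s ∈ Ioo 0 T) (ht0 : t ∈ Ioo 0 T) :
    ‖(∫ y, ζ y * u (t, y)) - ∫ y, ζ y * u (s, y)‖ₑ ≤
      ∫⁻ τ in Ioo 0 T, ∫⁻ y in D, ENNReal.ofReal (b * ((d : ℝ) ^ 2 * K + d + 1) *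
        (gradNorm d u (τ, y) + Real.sqrt (∑ i, fv i (τ, y) ^ 2) + r * |g (τ, y)|)) := by
  wlog hst : s ≤ t generalizing s t
  · rw [← neg_sub, enorm_neg]
    exact this ht0 hs0 (le_of_not_ge hst)
  have hsub : Ioc s t ⊆ Ioo 0 T := fun τ hτ => ⟨hs0.1.trans hτ.1, hτ.2.trans_lt ht0.2⟩
  rw [integral_cutoff_sub hζ.continuous (hs.trans hD) hζc hu hst]
  refine (enorm_integral_le_lintegral_enorm _).trans ?_
  refine le_trans ?_ (lintegral_mono_set hsub)
  refine setLIntegral_mono' measurableSet_Ioc fun τ hτ => ?_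
  rw [integral_cutoff_mul_ptime hζ (hs.trans hD) hζc hu hg hf
    fun y hy => heq τ (hsub hτ) y (hs hy)]
  refine (enorm_integral_le_lintegral_enorm _).trans ?_
  rw [← lintegral_indicator hDm]
  refine lintegral_mono fun y => ?_
  by_cases hy : y ∈ D
  · simp only [hy, indicator_of_mem]
    rw [← ofReal_norm, Real.norm_eq_abs]
    exact ENNReal.ofReal_le_ofReal (abs_cutoff_flux_le hK
      (fun i j => hA.abs_symm_le hδ τ i j) (hb y) hr (hb' y))
  · have h0 : y ∉ tsupport ζ := fun h => hy (hs h)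
    have h1 : ζ =ᶠ[nhds y] 0 := notMem_tsupport_iff_eventuallyEq.1 h0
    simp [h1.fderiv_eq, h1.eq_of_nhds]

end TimeIncrement

/-- Replacing a constant by the average costs at most a factor `2 ^ p` in an `L^p` oscillation. -/
theorem lintegral_sub_avgR_rpow_le {X : Type*} [MeasurableSpace X] {μ : Measure X} {S : Set X}
    {p : ℝ} (hp : 1 ≤ p) {u : X → ℝ} (hu : AEMeasurable u (μ.restrict S)) (hS : μ S ≠ ∞) (c : ℝ) :
    ∫⁻ z in S, ‖u z - avgR μ S u‖ₑ ^ p ∂μ ≤ 2 ^ p * ∫⁻ z in S, ‖u z - c‖ₑ ^ p ∂μ := by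
  have hp0 : 0 ≤ p := by linarith
  rcases eq_or_ne (μ S) 0 with h0 | h0
  · simp [Measure.restrict_eq_zero.2 h0]
  rcases eq_or_ne (∫⁻ z in S, ‖u z - c‖ₑ ^ p ∂μ) ∞ with hX | hX
  · rw [hX, ENNReal.mul_top (by simp)]
    exact le_top
  have hm : AEMeasurable (fun z => ‖u z - c‖ₑ) (μ.restrict S) := (hu.sub_const c).enorm
  have hJ := lintegral_rpow_le_measure_mul (μ.restrict S) hp hm
  rw [Measure.restrict_apply_univ] at hJ
  have : IsFiniteMeasure (μ.restrict S) := ⟨by simpa using hS.lt_top⟩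
  have hfin : ∫⁻ z in S, ‖u z - c‖ₑ ∂μ < ∞ := by
    by_contra h
    rw [not_lt, top_le_iff] at h
    rw [h, ENNReal.top_rpow_of_pos (by linarith), top_le_iff] at hJ
    exact ENNReal.mul_ne_top (ENNReal.rpow_ne_top_of_nonneg (by linarith) hS) hX hJ
  have hsub_int : Integrable (fun z => u z - c) (μ.restrict S) :=
    ⟨(hu.sub_const c).aestronglyMeasurable, hfin⟩
  have hui : Integrable u (μ.restrict S) := by
    have := hsub_int.add (integrable_const c)
    refine this.congr (.of_forall fun z => by simp)
  have havg : c - avgR μ S u = -((μ S).toReal⁻¹ * ∫ z in S, (u z - c) ∂μ) := by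
    rw [integral_sub hui (integrable_const c), avgR]
    have : (μ S).toReal ≠ 0 := ENNReal.toReal_ne_zero.2 ⟨h0, hS⟩
    simp only [integral_const, smul_eq_mul, Measure.real, Measure.restrict_apply_univ]
    field_simp
    ring
  have hc : ‖c - avgR μ S u‖ₑ ^ p * μ S ≤ ∫⁻ z in S, ‖u z - c‖ₑ ^ p ∂μ := by
    have h1 : ‖c - avgR μ S u‖ₑ ≤ (μ S)⁻¹ * ∫⁻ z in S, ‖u z - c‖ₑ ∂μ := by
      rw [havg, enorm_neg, enorm_mul]
      gcongr
      · rw [← ENNReal.toReal_inv, Real.enorm_eq_ofReal ENNReal.toReal_nonneg,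
          ENNReal.ofReal_toReal (ENNReal.inv_ne_top.2 h0)]
      · exact enorm_integral_le_lintegral_enorm _
    calc ‖c - avgR μ S u‖ₑ ^ p * μ S
        ≤ ((μ S)⁻¹ * ∫⁻ z in S, ‖u z - c‖ₑ ∂μ) ^ p * μ S := by gcongr
      _ = (μ S)⁻¹ ^ p * (∫⁻ z in S, ‖u z - c‖ₑ ∂μ) ^ p * μ S := by
          rw [ENNReal.mul_rpow_of_nonneg _ _ hp0]
      _ ≤ (μ S)⁻¹ ^ p * (μ S ^ (p - 1) * ∫⁻ z in S, ‖u z - c‖ₑ ^ p ∂μ) * μ S := by gcongr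
      _ = ((μ S)⁻¹ ^ p * μ S ^ p) * ∫⁻ z in S, ‖u z - c‖ₑ ^ p ∂μ := by
          have hV : μ S ^ p = μ S ^ (p - 1) * μ S := by
            conv_rhs => rw [← ENNReal.rpow_one (μ S), ← ENNReal.rpow_mul, one_mul]
            rw [← ENNReal.rpow_add_of_nonneg _ _ (by linarith) zero_le_one]
            simp
          rw [hV]
          ring
      _ = _ := by
          rw [← ENNReal.mul_rpow_of_nonneg _ _ hp0, ENNReal.inv_mul_cancel h0 hS,
            ENNReal.one_rpow, one_mul]
  calc ∫⁻ z in S, ‖u z - avgR μ S u‖ₑ ^ p ∂μ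
      ≤ ∫⁻ z in S, 2 ^ (p - 1) * (‖u z - c‖ₑ ^ p + ‖c - avgR μ S u‖ₑ ^ p) ∂μ := by
        refine lintegral_mono fun z => ?_
        refine le_trans ?_ (ENNReal.rpow_add_le_mul_rpow_add_rpow _ _ hp)
        gcongr
        rw [← sub_add_sub_cancel (u z) c]
        exact enorm_add_le _ _
    _ = 2 ^ (p - 1) * ((∫⁻ z in S, ‖u z - c‖ₑ ^ p ∂μ) + ‖c - avgR μ S u‖ₑ ^ p * μ S) := by
        rw [lintegral_const_mul' _ _ (ENNReal.rpow_ne_top_of_nonneg (by linarith) (by simp)),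
          lintegral_add_right _ measurable_const, lintegral_const, Measure.restrict_apply_univ]
    _ ≤ 2 ^ (p - 1) * ((∫⁻ z in S, ‖u z - c‖ₑ ^ p ∂μ) + ∫⁻ z in S, ‖u z - c‖ₑ ^ p ∂μ) := by
        gcongr
    _ = _ := by
        rw [← two_mul, ← mul_assoc]
        congr 1
        conv_lhs => rw [← ENNReal.rpow_one 2, ← ENNReal.rpow_mul, one_mul]
        rw [← ENNReal.rpow_add_of_nonneg _ _ (by linarith) zero_le_one]
        simp

/-- Integrals against `muW` over product sets, as iterated integrals. -/
theorem setLIntegral_muW_prod {d : ℕ} [NeZero d] (α : ℝ) {I : Set ℝ} {S : Set (Esp d)}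
    (hI : MeasurableSet I) (hS : MeasurableSet S) (hSp : S ⊆ halfSp d) {F : ℝ × Esp d → ℝ≥0∞}
    (hF : AEMeasurable F (volume.restrict (I ×ˢ S))) :
    ∫⁻ z in I ×ˢ S, F z ∂(muW d α) = ∫⁻ t in I, ∫⁻ x in S, wgt d α x * F (t, x) := by
  have hm : Measurable fun z : ℝ × Esp d => wgt d α z.2 := (measurable_wgt d α).comp measurable_snd
  have hsub : I ×ˢ S ⊆ halfST d := fun z hz => hSp hz.2
  have h1 : ∫⁻ z in I ×ˢ S, F z ∂(muW d α) = ∫⁻ z in I ×ˢ S, wgt d α z.2 * F z := by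
    rw [muW, Measure.restrict_restrict (hI.prod hS), inter_eq_left.2 hsub]
    exact setLIntegral_withDensity_eq_setLIntegral_mul_non_measurable _ hm F (hI.prod hS)
      (Filter.Eventually.of_forall fun _ => ENNReal.ofReal_lt_top)
  rw [h1]
  rw [Measure.volume_eq_prod, ← Measure.prod_restrict] at hF ⊢
  exact lintegral_prod _ (hm.aemeasurable.mul hF)

/-- Weighted integral of the `p`-th power of an unweighted integral over a subset on which the
weight is comparable to its maximum. -/
theorem lintegral_wgt_mul_rpow_lintegral_le {d : ℕ} [NeZero d] {α a p : ℝ} (hα : 0 ≤ α)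
    (ha : 0 ≤ a) (hp : 1 ≤ p) {I : Set ℝ} {S D : Set (Esp d)}
    (hSm : MeasurableSet S) (hDm : MeasurableSet D) (hDS : D ⊆ S)
    (hS : ∀ x ∈ S, 0 < x 0 ∧ x 0 ≤ 2 * a) (hD : ∀ y ∈ D, a ≤ y 0)
    {V : ℝ≥0∞} (hSV : volume S ≤ V) {F : ℝ × Esp d → ℝ≥0∞}
    (hF : AEMeasurable F (volume.restrict (I ×ˢ S))) :
    ∫⁻ _ in I, ∫⁻ x in S, wgt d α x * (∫⁻ τ in I, ∫⁻ y in D, F (τ, y)) ^ p ≤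
      ENNReal.ofReal (2 ^ α) * (volume I * V) ^ p *
        ∫⁻ τ in I, ∫⁻ y in S, wgt d α y * F (τ, y) ^ p := by
  have hp0 : 0 ≤ p := by linarith
  have hDV : volume D ≤ V := (measure_mono hDS).trans hSV
  have hFD : AEMeasurable F ((volume.restrict I).prod (volume.restrict D)) := by
    have := hF.mono_measure (Measure.restrict_mono (prod_mono (subset_refl I) hDS) le_rfl)
    rwa [Measure.volume_eq_prod, ← Measure.prod_restrict] at this
  set E := ∫⁻ τ in I, ∫⁻ y in D, F (τ, y) with hE
  have h1 : E ^ p ≤ (volume I * V) ^ (p - 1) * ∫⁻ τ in I, ∫⁻ y in D, F (τ, y) ^ p := by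
    have h := lintegral_rpow_le_measure_mul _ hp hFD
    rw [lintegral_prod _ hFD, lintegral_prod _ (hFD.pow_const p)] at h
    refine h.trans ?_
    gcongr
    rw [← univ_prod_univ, Measure.prod_prod, Measure.restrict_apply_univ,
      Measure.restrict_apply_univ]
    gcongr
  have h2 : ∫⁻ _ in I, ∫⁻ x in S, wgt d α x * E ^ p ≤
      ENNReal.ofReal (2 ^ α) * ENNReal.ofReal (a ^ α) * (volume I * V) * E ^ p := by
    calc _ ≤ ∫⁻ _ in I, ∫⁻ x in S,
          ENNReal.ofReal (2 ^ α) * ENNReal.ofReal (a ^ α) * E ^ p := by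
          refine lintegral_mono fun _ => setLIntegral_mono' hSm fun x hx => ?_
          gcongr
          rw [wgt, ← ENNReal.ofReal_mul (by positivity), ← Real.mul_rpow zero_le_two ha]
          have := hS x hx
          gcongr
          exacts [this.1.le, this.2]
      _ = ENNReal.ofReal (2 ^ α) * ENNReal.ofReal (a ^ α) * E ^ p * volume S * volume I := by
          simp
      _ ≤ ENNReal.ofReal (2 ^ α) * ENNReal.ofReal (a ^ α) * E ^ p * V * volume I := by gcongr
      _ = _ := by ring
  have h3 : ENNReal.ofReal (a ^ α) * ∫⁻ τ in I, ∫⁻ y in D, F (τ, y) ^ p ≤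
      ∫⁻ τ in I, ∫⁻ y in S, wgt d α y * F (τ, y) ^ p := by
    rw [← lintegral_const_mul' _ _ ENNReal.ofReal_ne_top]
    refine lintegral_mono fun τ => ?_
    rw [← lintegral_const_mul' _ _ ENNReal.ofReal_ne_top]
    refine le_trans ?_ (lintegral_mono_set hDS)
    refine setLIntegral_mono' hDm fun y hy => ?_
    gcongr
    exact ENNReal.ofReal_le_ofReal (by gcongr; exact hD y hy)
  have hV : (volume I * V) ^ p = (volume I * V) ^ (p - 1) * (volume I * V) := by
    conv_rhs => rw [← ENNReal.rpow_one (volume I * V), ← ENNReal.rpow_mul, one_mul]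
    rw [← ENNReal.rpow_add_of_nonneg _ _ (by linarith) zero_le_one]
    simp
  calc _ ≤ _ := h2
    _ ≤ ENNReal.ofReal (2 ^ α) * ENNReal.ofReal (a ^ α) * (volume I * V) *
        ((volume I * V) ^ (p - 1) * ∫⁻ τ in I, ∫⁻ y in D, F (τ, y) ^ p) := by gcongr
    _ = ENNReal.ofReal (2 ^ α) * (volume I * V) ^ p *
        (ENNReal.ofReal (a ^ α) * ∫⁻ τ in I, ∫⁻ y in D, F (τ, y) ^ p) := by
        rw [hV]
        ring
    _ ≤ _ := by gcongr

section Geometry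

variable {d : ℕ} [NeZero d] {r : ℝ}

theorem isOpen_sball (r : ℝ) (x : Esp d) : IsOpen (sball d r x) := by
  have h1 : IsOpen {y : Esp d | |y 0 - x 0| < r} := isOpen_lt (by fun_prop) continuous_const
  have h2 : IsOpen {y : Esp d |
      ∑ i ∈ Finset.univ.erase (0 : Fin d), (y i - x i) ^ 2 < r ^ 2} :=
    isOpen_lt (by fun_prop) continuous_const
  exact h1.inter h2

theorem convex_sball (r : ℝ) (x : Esp d) : Convex ℝ (sball d r x) := by
  have hsq : ∀ i : Fin d, ConvexOn ℝ univ fun y : Esp d => (y i - x i) ^ 2 := by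
    intro i
    refine ⟨convex_univ, fun y _ z _ a b ha hb hab => ?_⟩
    simp only [PiLp.add_apply, PiLp.smul_apply, smul_eq_mul]
    obtain rfl : b = 1 - a := by linarith
    nlinarith [mul_nonneg (mul_nonneg ha hb) (sq_nonneg (y i - z i))]
  have h2 : ConvexOn ℝ univ fun y : Esp d =>
      ∑ i ∈ Finset.univ.erase (0 : Fin d), (y i - x i) ^ 2 := by
    refine ⟨convex_univ, fun y hy z hz a b ha hb hab => ?_⟩
    simp only [smul_eq_mul, Finset.mul_sum, ← Finset.sum_add_distrib]
    exact Finset.sum_le_sum fun i _ => (hsq i).2 hy hz ha hb hab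
  have h1 : Convex ℝ {y : Esp d | |y 0 - x 0| < r} := by
    intro y hy z hz a b ha hb hab
    simp only [mem_ofPred_eq, PiLp.add_apply, PiLp.smul_apply, smul_eq_mul, abs_lt] at *
    obtain rfl : b = 1 - a := by linarith
    constructor
    · rcases ha.eq_or_lt with rfl | ha'
      · simp; linarith [hz.1]
      · nlinarith [mul_pos ha' (sub_pos.2 hy.1), mul_nonneg hb (sub_pos.2 hz.1).le]
    · rcases ha.eq_or_lt with rfl | ha'
      · simp; linarith [hz.2]
      · nlinarith [mul_pos ha' (sub_pos.2 hy.2), mul_nonneg hb (sub_pos.2 hz.2).le]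
  have h3 := h2.convex_lt (r ^ 2)
  simp only [mem_univ, true_and] at h3
  exact h1.inter h3

theorem sball_subset_ball (hr : 0 < r) (x : Esp d) : sball d r x ⊆ Metric.ball x (2 * r) := by
  intro y hy
  rw [mem_ball_iff_norm]
  refine lt_of_pow_lt_pow_left₀ 2 (by positivity) ?_
  rw [EuclideanSpace.real_norm_sq_eq, ← Finset.add_sum_erase _ _ (Finset.mem_univ (0 : Fin d))]
  have h1 := hy.2
  have h2 : (y 0 - x 0) ^ 2 < r ^ 2 := sq_lt_sq' (by linarith [(abs_lt.1 hy.1).1]) (abs_lt.1 hy.1).2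
  simp only [PiLp.sub_apply]
  nlinarith

theorem closedBall_subset_sball (hr : 0 < r) (a : ℝ) {y : Esp d}
    (hy : y ∈ Metric.closedBall (EuclideanSpace.single (0 : Fin d) (a + r / 2)) (r / 4)) :
    y ∈ sball d r (EuclideanSpace.single (0 : Fin d) a) ∧ a ≤ y 0 := by
  rw [mem_closedBall_iff_norm] at hy
  have h2 : ‖y - EuclideanSpace.single (0 : Fin d) (a + r / 2)‖ ^ 2 ≤ (r / 4) ^ 2 := by gcongr
  rw [EuclideanSpace.real_norm_sq_eq, ← Finset.add_sum_erase _ _ (Finset.mem_univ (0 : Fin d))]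
    at h2
  simp only [PiLp.sub_apply, PiLp.single_apply, if_true] at h2
  have h4 : 0 ≤ ∑ i ∈ Finset.univ.erase (0 : Fin d),
      (y i - if i = 0 then a + r / 2 else 0) ^ 2 := Finset.sum_nonneg fun _ _ => sq_nonneg _
  have h3 : |y 0 - (a + r / 2)| ≤ r / 4 := abs_le_of_sq_le_sq (by linarith) (by positivity)
  rw [abs_le] at h3
  refine ⟨⟨?_, ?_⟩, by linarith⟩
  · simp only [PiLp.single_apply, if_true]
    rw [abs_lt]
    constructor <;> linarith
  · have h5 : ∑ i ∈ Finset.univ.erase (0 : Fin d),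
        (y i - (EuclideanSpace.single (0 : Fin d) a : Esp d) i) ^ 2 =
        ∑ i ∈ Finset.univ.erase (0 : Fin d), (y i - if i = 0 then a + r / 2 else 0) ^ 2 :=
      Finset.sum_congr rfl fun i hi => by
        simp [Finset.ne_of_mem_erase hi]
    rw [h5]
    nlinarith [sq_nonneg (y 0 - (a + r / 2)), sq_pos_of_pos hr]

theorem volume_sball_le (hr : 0 < r) (x : Esp d) :
    volume (sball d r x) ≤
      ENNReal.ofReal (r ^ d * (volume (Metric.ball (0 : Esp d) 2)).toReal) := by
  refine (measure_mono (sball_subset_ball hr x)).trans ?_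
  rw [mul_comm 2 r, Measure.addHaar_ball_mul _ _ hr.le, ENNReal.ofReal_mul (by positivity),
    ENNReal.ofReal_toReal Metric.isBounded_ball.measure_lt_top.ne]
  simp

end Geometry

theorem rpow_add_add_le {p x y z : ℝ} (hp : 0 ≤ p) (hx : 0 ≤ x) (hy : 0 ≤ y) (hz : 0 ≤ z) :
    (x + y + z) ^ p ≤ 3 ^ p * (x ^ p + y ^ p + z ^ p) := by
  have hx' := Real.rpow_nonneg hx p
  have hy' := Real.rpow_nonneg hy p
  have hz' := Real.rpow_nonneg hz p
  have key : ∀ m, 0 ≤ m → x ≤ m → y ≤ m → z ≤ m → m ^ p ≤ x ^ p + y ^ p + z ^ p →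
      (x + y + z) ^ p ≤ 3 ^ p * (x ^ p + y ^ p + z ^ p) := fun m hm h1 h2 h3 h =>
    calc (x + y + z) ^ p ≤ (3 * m) ^ p := by
          gcongr
          linarith
      _ = 3 ^ p * m ^ p := Real.mul_rpow (by norm_num) hm
      _ ≤ _ := by gcongr
  rcases le_total x y with h | h
  · rcases le_total y z with h' | h'
    · exact key z hz (h.trans h') h' le_rfl (by linarith)
    · exact key y hy h le_rfl h' (by linarith)
  · rcases le_total x z with h' | h'
    · exact key z hz h' (h.trans h') le_rfl (by linarith)
    · exact key x hx le_rfl h h' (by linarith)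

theorem muW_sball_prod_ne_top {d : ℕ} [NeZero d] {α a T : ℝ} (hα : 0 ≤ α) {S : Set (Esp d)}
    (hSm : MeasurableSet S) (hSV : volume S ≠ ∞) (hS : ∀ x ∈ S, 0 < x 0 ∧ x 0 ≤ a) :
    muW d α (Ioo 0 T ×ˢ S) ≠ ∞ := by
  have h := setLIntegral_muW_prod (d := d) α (I := Ioo 0 T) measurableSet_Ioo hSm
    (fun x hx => (hS x hx).1) (F := fun _ => 1) aemeasurable_const
  simp only [lintegral_const, Measure.restrict_apply_univ, one_mul, mul_one] at h
  rw [h]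
  refine ENNReal.mul_ne_top (ne_top_of_le_ne_top (b := ENNReal.ofReal (a ^ α) * volume S)
    (ENNReal.mul_ne_top ENNReal.ofReal_ne_top hSV) ?_) (by simp)
  rw [← setLIntegral_const]
  refine setLIntegral_mono' hSm fun x hx => ENNReal.ofReal_le_ofReal ?_
  exact Real.rpow_le_rpow (hS x hx).1.le (hS x hx).2 hα

theorem enorm_rpow_eq_ofReal {E : Type*} [SeminormedAddCommGroup E] {p : ℝ} (hp : 0 ≤ p) (x : E) :
    ‖x‖ₑ ^ p = ENNReal.ofReal (‖x‖ ^ p) := by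
  rw [← ofReal_norm, ENNReal.ofReal_rpow_of_nonneg (norm_nonneg x) hp]

section Oscillation

variable {d : ℕ} [NeZero d] {p α K δ M r a : ℝ} {A : ℝ → Fin d → Fin d → ℝ}
  {u g : ℝ × Esp d → ℝ} {fv : Fin d → ℝ × Esp d → ℝ} {ζ : Esp d → ℝ}

theorem pos_of_mem_sball_single (hra : r ≤ a) {x : Esp d}
    (hx : x ∈ sball d r (EuclideanSpace.single (0 : Fin d) a)) : 0 < x 0 ∧ x 0 ≤ 2 * a := by
  have h := abs_lt.1 hx.1
  simp only [PiLp.single_apply, if_true] at h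
  constructor <;> linarith

/-- The data of the right-hand side, as a density on space-time. -/
def dataDensity (d : ℕ) (p r : ℝ) (u g : ℝ × Esp d → ℝ) (fv : Fin d → ℝ × Esp d → ℝ)
    (z : ℝ × Esp d) : ℝ≥0∞ :=
  ENNReal.ofReal (gradNorm d u z ^ p + Real.sqrt (∑ i, fv i z ^ 2) ^ p + r ^ p * |g z| ^ p)

/-- Oscillation in space about the weighted mean `∫ ζ u(t)`. -/
theorem lintegral_sub_cutoff_mean_le (hα : 0 ≤ α) (hp : 1 ≤ p) (hr : 0 < r) (hra : r ≤ a)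
    (hM : 0 < M) (hu : ContDiffOn ℝ (⊤ : ℕ∞) u (halfST d)) (hζ : ContDiff ℝ (⊤ : ℕ∞) ζ)
    (hζs : tsupport ζ ⊆
      Metric.closedBall (EuclideanSpace.single (0 : Fin d) (a + r / 2)) (r / 4))
    (hζ1 : ∫ y, ζ y = 1) (hζM : ∀ y, |ζ y| ≤ M / r ^ d) (I : Set ℝ) :
    ∫⁻ t in I, ∫⁻ x in sball d r (EuclideanSpace.single (0 : Fin d) a),
        wgt d α x * ‖u (t, x) - ∫ y, ζ y * u (t, y)‖ₑ ^ p ≤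
      ENNReal.ofReal ((M * (volume (Metric.ball (0 : Esp d) 2)).toReal * 4) ^ p * 4 ^ α * 2 ^ d *
          r ^ p) *
        ∫⁻ t in I, ∫⁻ x in sball d r (EuclideanSpace.single (0 : Fin d) a),
          wgt d α x * dataDensity d p r u g fv (t, x) := by
  have hp0 : 0 ≤ p := by linarith
  set S := sball d r (EuclideanSpace.single (0 : Fin d) a) with hSdef
  set ω := (volume (Metric.ball (0 : Esp d) 2)).toReal with hω
  have hω0 : 0 ≤ ω := ENNReal.toReal_nonneg
  have hSp : S ⊆ halfSp d := fun x hx => (pos_of_mem_sball_single hra hx).1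
  have hζc : HasCompactSupport ζ :=
    (isCompact_closedBall _ _).of_isClosed_subset (isClosed_tsupport ζ) hζs
  have hζS : tsupport ζ ⊆ halfSp d := fun y hy => hSp (closedBall_subset_sball hr a (hζs hy)).1
  rw [← lintegral_const_mul' _ _ ENNReal.ofReal_ne_top]
  refine lintegral_mono fun t => ?_
  have h := lintegral_sub_mean_rpow_le (L := 4 * r) (a := a) (v := fun y => u (t, y)) (ζ := ζ)
    (B := ENNReal.ofReal (M / r ^ d)) hα hp (isOpen_sball r _).measurableSet (convex_sball r _)
    Metric.isClosed_closedBall.measurableSet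
    (fun y hy => (closedBall_subset_sball hr a hy).1) (fun x hx => pos_of_mem_sball_single hra hx)
    (fun y hy => (closedBall_subset_sball hr a hy).2) (volume_sball_le hr _) ?_
    ((contDiffOn_space_slice hu t).of_le (by simp))
    (hζ.continuous.integrable_of_hasCompactSupport hζc)
    (integrable_cutoff_mul hζ.continuous hζS hζc hu.continuousOn t) hζ1
    (fun y hy => image_eq_zero_of_notMem_tsupport fun h => hy (hζs h)) ?_
    ENNReal.ofReal_ne_top ENNReal.ofReal_ne_top
  · refine h.trans ?_
    refine mul_le_mul' (le_of_eq ?_)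
      (setLIntegral_mono' (isOpen_sball r _).measurableSet fun x _ => ?_)
    · have h2 : (2 : ℝ≥0∞) ^ d = ENNReal.ofReal (2 ^ d) := by
        rw [ENNReal.ofReal_pow zero_le_two]
        simp
      rw [h2, ← ENNReal.ofReal_mul (by positivity),
        ENNReal.ofReal_rpow_of_nonneg (by positivity) hp0,
        ENNReal.ofReal_rpow_of_nonneg (by positivity) hp0, ← ENNReal.ofReal_mul (by positivity),
        ← ENNReal.ofReal_mul (by positivity), ← ENNReal.ofReal_mul (by positivity)]
      congr 1
      have h3 : M / r ^ d * (r ^ d * ω) = M * ω := by field_simp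
      rw [h3, Real.mul_rpow (by norm_num) hr.le,
        Real.mul_rpow (x := M * ω) (by positivity) (by norm_num)]
      ring
    · gcongr
      rw [enorm_rpow_eq_ofReal hp0]
      refine ENNReal.ofReal_le_ofReal ?_
      have h1 : 0 ≤ Real.sqrt (∑ i, fv i (t, x) ^ 2) ^ p := by positivity
      have h2 : 0 ≤ r ^ p * |g (t, x)| ^ p := by positivity
      change gradNorm d u (t, x) ^ p ≤ _
      linarith
  · intro x hx y hy
    have h1 := mem_ball_iff_norm.1 (sball_subset_ball hr _ hx)
    have h2 := mem_ball_iff_norm.1 (sball_subset_ball hr _ hy)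
    rw [← sub_sub_sub_cancel_right x y (EuclideanSpace.single (0 : Fin d) a)]
    exact (norm_sub_le _ _).trans (by linarith)
  · intro y
    rw [← ofReal_norm]
    exact ENNReal.ofReal_le_ofReal (hζM y)

theorem aemeasurable_flux (hu : ContDiffOn ℝ (⊤ : ℕ∞) u (halfST d))
    (hg : ContDiffOn ℝ (⊤ : ℕ∞) g (halfST d))
    (hf : ∀ i, ContDiffOn ℝ (⊤ : ℕ∞) (fv i) (halfST d)) {Q : Set (ℝ × Esp d)}
    (hQm : MeasurableSet Q) (hQ : Q ⊆ halfST d) (μ : Measure (ℝ × Esp d)) :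
    AEMeasurable (gradNorm d u) (μ.restrict Q) ∧
      AEMeasurable (fun z => Real.sqrt (∑ i, fv i z ^ 2)) (μ.restrict Q) ∧
      AEMeasurable (fun z => |g z|) (μ.restrict Q) := by
  refine ⟨((continuousOn_gradNorm hu).mono hQ).aemeasurable hQm, ContinuousOn.aemeasurable ?_ hQm,
    (hg.continuousOn.mono hQ).abs.aemeasurable hQm⟩
  exact (continuousOn_finsetSum _ fun i _ => ((hf i).continuousOn.mono hQ).pow 2).sqrt

theorem aemeasurable_dataDensity (hu : ContDiffOn ℝ (⊤ : ℕ∞) u (halfST d))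
    (hg : ContDiffOn ℝ (⊤ : ℕ∞) g (halfST d))
    (hf : ∀ i, ContDiffOn ℝ (⊤ : ℕ∞) (fv i) (halfST d)) {Q : Set (ℝ × Esp d)}
    (hQm : MeasurableSet Q) (hQ : Q ⊆ halfST d) (μ : Measure (ℝ × Esp d)) :
    AEMeasurable (dataDensity d p r u g fv) (μ.restrict Q) := by
  obtain ⟨h1, h2, h3⟩ := aemeasurable_flux hu hg hf hQm hQ μ
  exact (((h1.pow_const p).add (h2.pow_const p)).add ((h3.pow_const p).const_mul _)).ennreal_ofReal

/-- Oscillation in time of the weighted means `∫ ζ u(t)`. -/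
theorem lintegral_cutoff_mean_sub_le (hα : 0 ≤ α) (hp : 1 ≤ p) (hr : 0 < r) (hra : r ≤ a)
    (hM : 0 < M) (hu : ContDiffOn ℝ (⊤ : ℕ∞) u (halfST d))
    (hg : ContDiffOn ℝ (⊤ : ℕ∞) g (halfST d))
    (hf : ∀ i, ContDiffOn ℝ (⊤ : ℕ∞) (fv i) (halfST d)) (hA : ellipT d A δ K) (hδ : 0 < δ)
    (hK : 0 ≤ K) (hζ : ContDiff ℝ (⊤ : ℕ∞) ζ)
    (hζs : tsupport ζ ⊆
      Metric.closedBall (EuclideanSpace.single (0 : Fin d) (a + r / 2)) (r / 4))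
    (hζM : ∀ y, |ζ y| ≤ M / r ^ d) (hζ' : ∀ y, ‖fderiv ℝ ζ y‖ ≤ M / (r * r ^ d))
    (heq : ∀ z ∈ Ioo 0 (r ^ 2) ×ˢ sball d r (EuclideanSpace.single (0 : Fin d) a),
      ptime d u z + ∑ i, ∑ j, A z.1 i j * psp d i (psp d j u) z
        = (∑ i, psp d i (fv i) z) + g z)
    {s : ℝ} (hs : s ∈ Ioo 0 (r ^ 2)) :
    ∫⁻ t in Ioo 0 (r ^ 2), ∫⁻ x in sball d r (EuclideanSpace.single (0 : Fin d) a),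
        wgt d α x * ‖(∫ y, ζ y * u (t, y)) - ∫ y, ζ y * u (s, y)‖ₑ ^ p ≤
      ENNReal.ofReal (2 ^ α * ((volume (Metric.ball (0 : Esp d) 2)).toReal * M *
          ((d : ℝ) ^ 2 * K + d + 1) * 3) ^ p * r ^ p) *
        ∫⁻ t in Ioo 0 (r ^ 2), ∫⁻ x in sball d r (EuclideanSpace.single (0 : Fin d) a),
          wgt d α x * dataDensity d p r u g fv (t, x) := by
  have hp0 : 0 ≤ p := by linarith
  set S := sball d r (EuclideanSpace.single (0 : Fin d) a) with hSdef
  set D := Metric.closedBall (EuclideanSpace.single (0 : Fin d) (a + r / 2)) (r / 4) with hD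
  set ω := (volume (Metric.ball (0 : Esp d) 2)).toReal with hω
  set C := (d : ℝ) ^ 2 * K + d + 1 with hC
  set b := M / (r * r ^ d) with hb
  have hω0 : 0 ≤ ω := ENNReal.toReal_nonneg
  have hC0 : 0 ≤ C := by positivity
  have hb0 : 0 ≤ b := by positivity
  have hSm : MeasurableSet S := (isOpen_sball r _).measurableSet
  have hSp : S ⊆ halfSp d := fun x hx => (pos_of_mem_sball_single hra hx).1
  have hDS : D ⊆ S := fun y hy => (closedBall_subset_sball hr a hy).1
  have hζc : HasCompactSupport ζ :=
    (isCompact_closedBall _ _).of_isClosed_subset (isClosed_tsupport ζ) hζs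
  have hQm : MeasurableSet (Ioo 0 (r ^ 2) ×ˢ S) := measurableSet_Ioo.prod hSm
  have hQ : Ioo 0 (r ^ 2) ×ˢ S ⊆ halfST d := fun z hz => hSp hz.2
  set F : ℝ × Esp d → ℝ≥0∞ := fun z => ENNReal.ofReal (b * C *
    (gradNorm d u z + Real.sqrt (∑ i, fv i z ^ 2) + r * |g z|)) with hF
  have hFm : AEMeasurable F (volume.restrict (Ioo 0 (r ^ 2) ×ˢ S)) := by
    obtain ⟨h1, h2, h3⟩ := aemeasurable_flux hu hg hf hQm hQ volume
    exact (((h1.add h2).add (h3.const_mul r)).const_mul _).ennreal_ofReal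
  have hFp : ∀ z, F z ^ p ≤ ENNReal.ofReal ((b * C * 3) ^ p) * dataDensity d p r u g fv z := by
    intro z
    have h0 : 0 ≤ gradNorm d u z := norm_nonneg _
    rw [hF, dataDensity, ENNReal.ofReal_rpow_of_nonneg (by positivity) hp0,
      ← ENNReal.ofReal_mul (by positivity), Real.mul_rpow (by positivity) (by positivity),
      Real.mul_rpow (y := 3) (by positivity) (by positivity), mul_assoc (_ ^ p),
      ← Real.mul_rpow hr.le (abs_nonneg _)]
    gcongr
    exact rpow_add_add_le hp0 h0 (by positivity) (by positivity)
  calc _ ≤ ∫⁻ _ in Ioo 0 (r ^ 2), ∫⁻ x in S, wgt d α x *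
        (∫⁻ τ in Ioo 0 (r ^ 2), ∫⁻ y in D, F (τ, y)) ^ p := by
        refine setLIntegral_mono' measurableSet_Ioo fun t ht => lintegral_mono fun x => ?_
        gcongr
        refine enorm_integral_cutoff_sub_le hζ hζc Metric.isClosed_closedBall.measurableSet
          (hDS.trans hSp) hζs hu hg hf hA hδ hK hr.le hζ' (fun y => ?_)
          (fun τ hτ y hy => heq (τ, y) ⟨hτ, hDS hy⟩) hs ht
        refine (hζM y).trans (le_of_eq ?_)
        rw [hb]
        field_simp
    _ ≤ _ := lintegral_wgt_mul_rpow_lintegral_le hα (hr.le.trans hra) hp hSm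
        Metric.isClosed_closedBall.measurableSet hDS
        (fun x hx => pos_of_mem_sball_single hra hx)
        (fun y hy => (closedBall_subset_sball hr a hy).2) (volume_sball_le hr _) hFm
    _ ≤ ENNReal.ofReal (2 ^ α) *
          (volume (Ioo 0 (r ^ 2)) * ENNReal.ofReal (r ^ d * ω)) ^ p *
        (ENNReal.ofReal ((b * C * 3) ^ p) * ∫⁻ t in Ioo 0 (r ^ 2), ∫⁻ x in S,
          wgt d α x * dataDensity d p r u g fv (t, x)) := by
        gcongr
        rw [← lintegral_const_mul' _ _ ENNReal.ofReal_ne_top]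
        refine lintegral_mono fun t => ?_
        rw [← lintegral_const_mul' _ _ ENNReal.ofReal_ne_top]
        refine lintegral_mono fun x => ?_
        rw [mul_left_comm]
        gcongr
        exact hFp _
    _ = _ := by
        rw [← mul_assoc, Real.volume_Ioo, sub_zero, ← ENNReal.ofReal_mul (by positivity),
          ENNReal.ofReal_rpow_of_nonneg (by positivity) hp0, ← ENNReal.ofReal_mul (by positivity),
          ← ENNReal.ofReal_mul (by positivity), mul_assoc (2 ^ α : ℝ),
          mul_assoc (2 ^ α : ℝ),
          ← Real.mul_rpow (by positivity) (by positivity),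
          ← Real.mul_rpow (by positivity) (by positivity)]
        congr 4
        rw [hb]
        field_simp

end Oscillation

/-- **Weighted cylinder oscillation estimate for solutions of divergence-type
parabolic equations.** -/
theorem stmt4 (d : ℕ) [NeZero d] (p θ δ K : ℝ)
    (hp : 1 ≤ p) (hθ₁ : (d : ℝ) - 1 < θ) (hθ₂ : θ < (d : ℝ) - 1 + p)
    (hδ : 0 < δ) (hδK : δ ≤ K) :
    ∃ N : ℝ, 0 < N ∧
      ∀ A : ℝ → Fin d → Fin d → ℝ, (∀ i j, Measurable fun t => A t i j) →
        ellipT d A δ K →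
      ∀ (u g : ℝ × Esp d → ℝ) (fv : Fin d → ℝ × Esp d → ℝ),
        ContDiffOn ℝ (⊤ : ℕ∞) u (halfST d) → ContDiffOn ℝ (⊤ : ℕ∞) g (halfST d) →
        (∀ i, ContDiffOn ℝ (⊤ : ℕ∞) (fv i) (halfST d)) →
      ∀ aa r : ℝ, 0 < r → r ≤ aa →
        (∀ z ∈ cylA d r aa,
          ptime d u z + ∑ i, ∑ j, A z.1 i j * psp d i (psp d j u) z
            = (∑ i, psp d i (fv i) z) + g z) →
        (∫⁻ z in cylA d r aa,
            ENNReal.ofReal (|u z - avgR (muW d (θ - d + p)) (cylA d r aa) u| ^ p)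
            ∂(muW d (θ - d + p))) ≤
          ENNReal.ofReal (N * r ^ p) *
            ∫⁻ z in cylA d r aa,
              ENNReal.ofReal
                (gradNorm d u z ^ p + Real.sqrt (∑ i, fv i z ^ 2) ^ p + r ^ p * |g z| ^ p)
              ∂(muW d (θ - d + p)) := by
  obtain ⟨M, hM, hbump⟩ := exists_scaled_bump d
  set α := θ - d + p with hαdef
  have hα : 0 ≤ α := by linarith
  have hp0 : 0 ≤ p := by linarith
  have hK : 0 ≤ K := hδ.le.trans hδK
  set ω := (volume (Metric.ball (0 : Esp d) 2)).toReal with hω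
  have hω0 : 0 ≤ ω := ENNReal.toReal_nonneg
  set N₁ := (M * ω * 4) ^ p * 4 ^ α * 2 ^ d with hN₁
  set N₂ := 2 ^ α * (ω * M * ((d : ℝ) ^ 2 * K + d + 1) * 3) ^ p with hN₂
  have hN₁0 : 0 ≤ N₁ := by positivity
  have hN₂0 : 0 ≤ N₂ := by positivity
  refine ⟨2 ^ p * 2 ^ (p - 1) * (N₁ + N₂ + 1), by positivity, ?_⟩
  intro A _ hA u g fv hu hg hf a r hr hra heq
  have hcyl : cylA d r a = Ioo 0 (r ^ 2) ×ˢ sball d r (EuclideanSpace.single (0 : Fin d) a) := by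
    rw [cylA, pcyl, zero_add]
  rw [hcyl] at heq ⊢
  obtain ⟨ζ, hζ, hζs, hζ1, hζM, hζ'⟩ :=
    hbump (EuclideanSpace.single (0 : Fin d) (a + r / 2)) r hr
  set S := sball d r (EuclideanSpace.single (0 : Fin d) a) with hSdef
  have hSm : MeasurableSet S := (isOpen_sball r _).measurableSet
  have hSp : S ⊆ halfSp d := fun x hx => (pos_of_mem_sball_single hra hx).1
  have hζS : tsupport ζ ⊆ halfSp d := fun y hy => hSp (closedBall_subset_sball hr a (hζs hy)).1
  have hQm : MeasurableSet (Ioo 0 (r ^ 2) ×ˢ S) := measurableSet_Ioo.prod hSm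
  have hQ : Ioo 0 (r ^ 2) ×ˢ S ⊆ halfST d := fun z hz => hSp hz.2
  have hum : ∀ μ : Measure (ℝ × Esp d), AEMeasurable u (μ.restrict (Ioo 0 (r ^ 2) ×ˢ S)) :=
    fun μ => (hu.continuousOn.mono hQ).aemeasurable hQm
  have hs : r ^ 2 / 2 ∈ Ioo 0 (r ^ 2) := ⟨by positivity, by linarith [sq_pos_of_pos hr]⟩
  set m : ℝ → ℝ := fun t => ∫ y, ζ y * u (t, y) with hm
  have hmm : Measurable m :=
    ((continuous_cutoff_mul hζ.continuous hζS
      hu.continuousOn).stronglyMeasurable.integral_prod_right).measurable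
  have hmm' : Measurable fun z : ℝ × Esp d => ‖m z.1 - m (r ^ 2 / 2)‖ₑ ^ p :=
    (((hmm.comp measurable_fst).sub_const _).enorm).pow_const p
  have hspace : AEMeasurable (fun z : ℝ × Esp d => ‖u z - m z.1‖ₑ ^ p)
      (volume.restrict (Ioo 0 (r ^ 2) ×ˢ S)) :=
    (((hum volume).sub (hmm.comp measurable_fst).aemeasurable).enorm).pow_const p
  set J := ∫⁻ z in Ioo 0 (r ^ 2) ×ˢ S, dataDensity d p r u g fv z ∂(muW d α) with hJ
  have hJ' := setLIntegral_muW_prod α measurableSet_Ioo hSm hSp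
    (aemeasurable_dataDensity (p := p) (r := r) hu hg hf hQm hQ volume)
  have h1 : ∫⁻ z in Ioo 0 (r ^ 2) ×ˢ S, ‖u z - m z.1‖ₑ ^ p ∂(muW d α) ≤
      ENNReal.ofReal (N₁ * r ^ p) * J := by
    rw [hJ, hJ', setLIntegral_muW_prod α measurableSet_Ioo hSm hSp hspace]
    exact lintegral_sub_cutoff_mean_le hα hp hr hra hM hu hζ hζs hζ1 hζM _
  have h2 : ∫⁻ z in Ioo 0 (r ^ 2) ×ˢ S, ‖m z.1 - m (r ^ 2 / 2)‖ₑ ^ p ∂(muW d α) ≤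
      ENNReal.ofReal (N₂ * r ^ p) * J := by
    rw [hJ, hJ', setLIntegral_muW_prod α measurableSet_Ioo hSm hSp hmm'.aemeasurable]
    exact lintegral_cutoff_mean_sub_le hα hp hr hra hM hu hg hf hA hδ hK hζ hζs hζM hζ' heq hs
  have hfin : muW d α (Ioo 0 (r ^ 2) ×ˢ S) ≠ ∞ :=
    muW_sball_prod_ne_top hα hSm
      (ne_top_of_le_ne_top ENNReal.ofReal_ne_top (volume_sball_le hr _))
      fun x hx => pos_of_mem_sball_single hra hx
  have h2p : (2 : ℝ≥0∞) ^ (p - 1) ≠ ∞ :=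
    ENNReal.rpow_ne_top_of_nonneg (by linarith) ENNReal.ofNat_ne_top
  have htwo : ∀ q : ℝ, 0 ≤ q → (2 : ℝ≥0∞) ^ q = ENNReal.ofReal (2 ^ q) := fun q hq => by
    rw [← ENNReal.ofReal_rpow_of_nonneg zero_le_two hq]
    simp
  calc _ = ∫⁻ z in Ioo 0 (r ^ 2) ×ˢ S,
          ‖u z - avgR (muW d α) (Ioo 0 (r ^ 2) ×ˢ S) u‖ₑ ^ p ∂(muW d α) := by
        simp only [enorm_rpow_eq_ofReal hp0, Real.norm_eq_abs]
    _ ≤ 2 ^ p * ∫⁻ z in Ioo 0 (r ^ 2) ×ˢ S, ‖u z - m (r ^ 2 / 2)‖ₑ ^ p ∂(muW d α) :=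
        lintegral_sub_avgR_rpow_le hp (hum _) hfin _
    _ ≤ 2 ^ p * ∫⁻ z in Ioo 0 (r ^ 2) ×ˢ S,
          2 ^ (p - 1) * (‖u z - m z.1‖ₑ ^ p + ‖m z.1 - m (r ^ 2 / 2)‖ₑ ^ p) ∂(muW d α) := by
        gcongr with z
        refine le_trans ?_ (ENNReal.rpow_add_le_mul_rpow_add_rpow _ _ hp)
        gcongr
        rw [← sub_add_sub_cancel (u z) (m z.1)]
        exact enorm_add_le _ _
    _ ≤ 2 ^ p * (2 ^ (p - 1) *
          (ENNReal.ofReal (N₁ * r ^ p) * J + ENNReal.ofReal (N₂ * r ^ p) * J)) := by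
        rw [lintegral_const_mul' _ _ h2p, lintegral_add_right _ hmm']
        gcongr
    _ = ENNReal.ofReal (2 ^ p * 2 ^ (p - 1) * (N₁ + N₂) * r ^ p) * J := by
        rw [← add_mul, ← mul_assoc, ← mul_assoc, ← ENNReal.ofReal_add (by positivity)
          (by positivity), htwo p hp0, htwo (p - 1) (by linarith),
          ← ENNReal.ofReal_mul (by positivity), ← ENNReal.ofReal_mul (by positivity)]
        congr 2
        ring
    _ ≤ _ := by
        refine mul_le_mul' (ENNReal.ofReal_le_ofReal ?_) le_rfl
        exact mul_le_mul_of_nonneg_right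
          (mul_le_mul_of_nonneg_left (by linarith) (by positivity)) (by positivity)
end
end
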